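/- arXiv:solv-int/9906013 — 9 statements merged into one kernel-verified Lean document; each statement's English description precedes it below -/
import Mathlib

section
/- Let G be a group and x, x₊, x₋ : ℕ → G sequences such that for every k, x(k) = x₊(k)·x₋(k)⁻¹ and x(k+1) = x₋(k)⁻¹·x₊(k). Define g₊(n) = x₊(0)·x₊(1)⋯x₊(n−1) and g₋(n) = x₋(0)·x₋(1)⋯x₋(n−1) (ordered products, with g₊(0) = g₋(0) = 1). Then for every n: (x(0))ⁿ = g₊(n)·g₋(n)⁻¹ and x(n) = g₊(n)⁻¹·x(0)·g₊(n). (Trajectories of the factorization map are obtained by factorizing powers of the initial condition.) -/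
/-- Trajectories of the factorization dynamics `x(k) = x₊(k)·x₋(k)⁻¹`,
`x(k+1) = x₋(k)⁻¹·x₊(k)` are obtained by factorizing powers of the initial condition:
with `g₊(n) = x₊(0)⋯x₊(n-1)` and `g₋(n) = x₋(0)⋯x₋(n-1)` one has
`(x 0)^n = g₊(n)·g₋(n)⁻¹` and `x n = g₊(n)⁻¹·x(0)·g₊(n)`. -/
theorem factorization_dynamics_trajectory
    {G : Type*} [Group G] (x xp xm : ℕ → G)
    (hfac : ∀ k, x k = xp k * (xm k)⁻¹)
    (hrec : ∀ k, x (k + 1) = (xm k)⁻¹ * xp k) :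
    ∀ n : ℕ,
      (x 0) ^ n = ((List.range n).map xp).prod * (((List.range n).map xm).prod)⁻¹ ∧
      x n = (((List.range n).map xp).prod)⁻¹ * x 0 * ((List.range n).map xp).prod := by
  intro n
  induction n with
  | zero => simp
  | succ n ih =>
    obtain ⟨h1, h2⟩ := ih
    rw [List.range_succ, List.map_append, List.map_append, List.prod_append, List.prod_append]
    simp only [List.map_cons, List.map_nil, List.prod_singleton]
    generalize ((List.range n).map xp).prod = P at *
    generalize ((List.range n).map xm).prod = M at *
    constructor
    · have h3 : P * xp n * (M * xm n)⁻¹ = P * (xp n * (xm n)⁻¹) * M⁻¹ := by group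
      rw [h3, ← hfac n, h2, pow_succ', h1]
      group
    · have h3 : (P * xp n)⁻¹ * x 0 * (P * xp n) = (xp n)⁻¹ * (P⁻¹ * x 0 * P) * xp n := by
        group
      rw [h3, ← h2, hfac n, hrec n]
      group
end

section
/- Fix n ≥ 2 and A_i, D_i ∈ ℂ*, B_i, C_i ∈ ℂ for i = 1,…,n−1. Let P be the diagonal n×n matrix with P_kk = A_k/A_{k−1} and Q the diagonal matrix with Q_kk = D_{k−1}/D_k (k = 1,…,n, conventions A₀ = D₀ = A_n = D_n = 1). Set Ṽ_i = B_i·A_i⁻¹·A_{i+1} and W̃_i = C_i·D_i·D_{i−1}⁻¹. Then U_1(A_1,B_1)⋯U_{n−1}(A_{n−1},B_{n−1})·L_1(D_1,C_1)⁻¹⋯L_{n−1}(D_{n−1},C_{n−1})⁻¹ = P·U_1(1,Ṽ_1)·L_1(1,W̃_1)⁻¹·U_2(1,Ṽ_2)·L_2(1,W̃_2)⁻¹⋯U_{n−1}(1,Ṽ_{n−1})·L_{n−1}(1,W̃_{n−1})⁻¹·Q. (First identity of the factorization of U·L⁻¹ on a Coxeter leaf, for SL_n.) -/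
open scoped Matrix

/-- `Umat n i A B` is the `n×n` identity matrix except that its `2×2` submatrix in
rows and columns `i, i+1` (1-based indexing, `1 ≤ i ≤ n-1`) is `[[A, B], [0, A⁻¹]]`. -/
noncomputable def Umat (n : ℕ) (i : ℕ) (A B : ℂ) : Matrix (Fin n) (Fin n) ℂ := fun j k =>
  if (j : ℕ) + 1 = i ∧ (k : ℕ) + 1 = i then A
  else if (j : ℕ) + 1 = i ∧ (k : ℕ) = i then B
  else if (j : ℕ) = i ∧ (k : ℕ) = i then A⁻¹
  else if j = k then 1 else 0

/-- `Lmat n i D C` is the `n×n` identity matrix except that its `2×2` submatrix in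
rows and columns `i, i+1` (1-based indexing, `1 ≤ i ≤ n-1`) is `[[D, 0], [C, D⁻¹]]`. -/
noncomputable def Lmat (n : ℕ) (i : ℕ) (D C : ℂ) : Matrix (Fin n) (Fin n) ℂ := fun j k =>
  if (j : ℕ) + 1 = i ∧ (k : ℕ) + 1 = i then D
  else if (j : ℕ) = i ∧ (k : ℕ) + 1 = i then C
  else if (j : ℕ) = i ∧ (k : ℕ) = i then D⁻¹
  else if j = k then 1 else 0

theorem tele_aux {M : Type*} [Monoid M] (R f g : ℕ → M) (m s : ℕ)
    (h : ∀ i, s ≤ i → i < s + m → R i * f (i + 1) = g (i + 1) * R (i + 1)) :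
    R s * ((List.range' (s + 1) m).map f).prod = ((List.range' (s + 1) m).map g).prod * R (s + m) := by
  induction m generalizing s with
  | zero => simp
  | succ m ih =>
    simp only [List.range'_succ, List.map_cons, List.prod_cons]
    rw [← mul_assoc, h s le_rfl (by omega), mul_assoc,
      ih (s + 1) (fun i h1 h2 => h i (by omega) (by omega)), mul_assoc]
    congr 3
    omega

theorem prod_mul_aux {M : Type*} [Monoid M] (f g : ℕ → M) (l : List ℕ) (hl : l.Nodup)
    (h : ∀ i ∈ l, ∀ j ∈ l, i ≠ j → Commute (f i) (g j)) :
    (l.map (fun i => f i * g i)).prod = (l.map f).prod * (l.map g).prod := by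
  induction l with
  | nil => simp
  | cons a l ih =>
    rw [List.nodup_cons] at hl
    have hc : Commute (l.map f).prod (g a) := by
      apply Commute.list_prod_left
      intro x hx
      obtain ⟨b, hb, rfl⟩ := List.mem_map.1 hx
      refine h b (by simp [hb]) a (by simp) ?_
      rintro rfl
      exact hl.1 hb
    simp only [List.map_cons, List.prod_cons]
    rw [ih hl.2 (fun i hi j hj => h i (by simp [hi]) j (by simp [hj]))]
    calc f a * g a * ((l.map f).prod * (l.map g).prod)
        = f a * (g a * (l.map f).prod) * (l.map g).prod := by simp only [mul_assoc]
      _ = _ := by rw [← hc.eq]; simp only [mul_assoc]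

theorem Umat_one (n i : ℕ) (hi : i + 1 < n) (x : ℂ) :
    Umat n (i + 1) 1 x = Matrix.transvection ⟨i, by omega⟩ ⟨i + 1, hi⟩ x := by
  ext j k
  simp only [Umat, Matrix.transvection, Matrix.add_apply, Matrix.one_apply, Matrix.single_apply,
    Fin.ext_iff, inv_one]
  split_ifs <;> first | omega | simp

theorem Lmat_one (n i : ℕ) (hi : i + 1 < n) (x : ℂ) :
    Lmat n (i + 1) 1 x = Matrix.transvection ⟨i + 1, hi⟩ ⟨i, by omega⟩ x := by
  ext j k
  simp only [Lmat, Matrix.transvection, Matrix.add_apply, Matrix.one_apply, Matrix.single_apply,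
    Fin.ext_iff, inv_one]
  split_ifs <;> first | omega | simp

theorem UL_commute (n i j : ℕ) (hi : i + 1 < n) (hj : j + 1 < n) (h : i ≠ j) (x y : ℂ) :
    Commute (Umat n (i + 1) 1 x) (Lmat n (j + 1) 1 y) := by
  rw [Umat_one n i hi, Lmat_one n j hj]
  unfold Commute SemiconjBy Matrix.transvection
  have h1 : Matrix.single (⟨i, by omega⟩ : Fin n) (⟨i + 1, hi⟩ : Fin n) x *
      Matrix.single (⟨j + 1, hj⟩ : Fin n) (⟨j, by omega⟩ : Fin n) y = 0 :=
    by
    apply Matrix.single_mul_single_of_ne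
    simp [h]
  have h2 : Matrix.single (⟨j + 1, hj⟩ : Fin n) (⟨j, by omega⟩ : Fin n) y *
      Matrix.single (⟨i, by omega⟩ : Fin n) (⟨i + 1, hi⟩ : Fin n) x = 0 :=
    by
    apply Matrix.single_mul_single_of_ne
    simp [Ne.symm h]
  simp only [mul_add, add_mul, mul_one, one_mul, h1, h2]
  abel

noncomputable def Raux (n : ℕ) (A : ℕ → ℂ) (m : ℕ) : Matrix (Fin n) (Fin n) ℂ :=
  Matrix.diagonal fun k =>
    if (k : ℕ) < m then 1 else if (k : ℕ) = m then A (m + 1) else A ((k : ℕ) + 1) / A k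

noncomputable def Saux (n : ℕ) (D : ℕ → ℂ) (m : ℕ) : Matrix (Fin n) (Fin n) ℂ :=
  Matrix.diagonal fun k =>
    if (k : ℕ) < m then D k / D ((k : ℕ) + 1) else if (k : ℕ) = m then D m else 1

theorem Raux_step (n : ℕ) (A B : ℕ → ℂ) (hA : ∀ k, A k ≠ 0) (i : ℕ) :
    Raux n A i * Umat n (i + 1) 1 (B (i + 1) * (A (i + 1))⁻¹ * A (i + 1 + 1)) =
      Umat n (i + 1) (A (i + 1)) (B (i + 1)) * Raux n A (i + 1) := by
  ext ⟨j, hj⟩ ⟨k, hk⟩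
  have := hA (i + 1)
  simp only [Raux, Matrix.diagonal_mul, Matrix.mul_diagonal, Umat, Fin.mk.injEq]
  split_ifs <;> first | omega | (subst_vars; first | omega | (simp; done) | (field_simp; done) | grind)

theorem Saux_step (n : ℕ) (C D : ℕ → ℂ) (hD : ∀ k, D k ≠ 0) (i : ℕ) :
    Saux n D (i + 1) * Lmat n (i + 1) (D (i + 1)) (C (i + 1)) =
      Lmat n (i + 1) 1 (C (i + 1) * D (i + 1) * (D i)⁻¹) * Saux n D i := by
  ext ⟨j, hj⟩ ⟨k, hk⟩
  have := hD (i + 1)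
  have := hD i
  simp only [Saux, Matrix.diagonal_mul, Matrix.mul_diagonal, Lmat, Fin.mk.injEq]
  split_ifs <;> first | omega | (subst_vars; first | omega | (simp; done) | (field_simp; done) | grind)

theorem Saux_det (n : ℕ) (D : ℕ → ℂ) (hD : ∀ k, D k ≠ 0) (m : ℕ) : (Saux n D m).det ≠ 0 := by
  rw [Saux, Matrix.det_diagonal, Finset.prod_ne_zero_iff]
  intro k _
  split_ifs <;> simp [hD]

theorem Lmat_one_det (n i : ℕ) (hi : i + 1 < n) (x : ℂ) : (Lmat n (i + 1) 1 x).det = 1 := by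
  rw [Lmat_one n i hi]
  exact Matrix.det_transvection_of_ne _ _ (by simp) _

theorem Saux_step_inv (n : ℕ) (C D : ℕ → ℂ) (hD : ∀ k, D k ≠ 0) (i : ℕ) (hi : i + 1 < n) :
    Saux n D i * (Lmat n (i + 1) (D (i + 1)) (C (i + 1)))⁻¹ =
      (Lmat n (i + 1) 1 (C (i + 1) * D (i + 1) * (D i)⁻¹))⁻¹ * Saux n D (i + 1) := by
  have h := Saux_step n C D hD i
  have hT := Lmat_one_det n i hi (C (i + 1) * D (i + 1) * (D i)⁻¹)
  set T := Lmat n (i + 1) 1 (C (i + 1) * D (i + 1) * (D i)⁻¹)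
  set L := Lmat n (i + 1) (D (i + 1)) (C (i + 1))
  have hL : IsUnit L.det := by
    have h2 := congrArg Matrix.det h
    rw [Matrix.det_mul, Matrix.det_mul, hT, one_mul] at h2
    rw [isUnit_iff_ne_zero]
    intro h0
    rw [h0, mul_zero] at h2
    exact Saux_det n D hD i h2.symm
  have hT' : IsUnit T.det := by rw [hT]; exact isUnit_one
  calc Saux n D i * L⁻¹ = T⁻¹ * (T * Saux n D i) * L⁻¹ := by
        rw [← mul_assoc, Matrix.nonsing_inv_mul _ hT', one_mul]
    _ = T⁻¹ * Saux n D (i + 1) := by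
        rw [← h, mul_assoc, mul_assoc, Matrix.mul_nonsing_inv _ hL, mul_one]

/-- First identity of the factorization of `U·L⁻¹` on a Coxeter leaf, for `SL_n`:
`U₁(A₁,B₁)⋯U_{n−1}(A_{n−1},B_{n−1})·L₁(D₁,C₁)⁻¹⋯L_{n−1}(D_{n−1},C_{n−1})⁻¹
 = P · ∏ᵢ (Uᵢ(1,Ṽᵢ)·Lᵢ(1,W̃ᵢ)⁻¹) · Q` with `Ṽᵢ = Bᵢ Aᵢ⁻¹ A_{i+1}`,
`W̃ᵢ = Cᵢ Dᵢ D_{i-1}⁻¹`, `P = diag(A_k/A_{k-1})`, `Q = diag(D_{k-1}/D_k)`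
(conventions `A₀ = D₀ = A_n = D_n = 1`). -/
theorem coxeter_leaf_factorization_first_identity
    (n : ℕ) (hn : 2 ≤ n) (A B C D : ℕ → ℂ)
    (hA : ∀ k, A k ≠ 0) (hD : ∀ k, D k ≠ 0)
    (hA0 : A 0 = 1) (hAn : A n = 1) (hD0 : D 0 = 1) (hDn : D n = 1) :
    ((List.range' 1 (n - 1)).map (fun i => Umat n i (A i) (B i))).prod *
      ((List.range' 1 (n - 1)).map (fun i => (Lmat n i (D i) (C i))⁻¹)).prod =
    Matrix.diagonal (fun k : Fin n => A ((k : ℕ) + 1) / A (k : ℕ)) *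
      ((List.range' 1 (n - 1)).map
        (fun i => Umat n i 1 (B i * (A i)⁻¹ * A (i + 1)) *
          (Lmat n i 1 (C i * D i * (D (i - 1))⁻¹))⁻¹)).prod *
      Matrix.diagonal (fun k : Fin n => D (k : ℕ) / D ((k : ℕ) + 1)) := by
  have hR := tele_aux (Raux n A) (fun i => Umat n i 1 (B i * (A i)⁻¹ * A (i + 1)))
    (fun i => Umat n i (A i) (B i)) (n - 1) 0 (fun i _ _ => Raux_step n A B hA i)
  have hS := tele_aux (Saux n D) (fun i => (Lmat n i (D i) (C i))⁻¹)
    (fun i => (Lmat n i 1 (C i * D i * (D (i - 1))⁻¹))⁻¹) (n - 1) 0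
    (fun i _ h => Saux_step_inv n C D hD i (by omega))
  have hR0 : Raux n A 0 = Matrix.diagonal (fun k : Fin n => A ((k : ℕ) + 1) / A (k : ℕ)) := by
    unfold Raux
    congr 1
    ext ⟨k, hk⟩
    by_cases h : k = 0
    · subst h; simp [hA0]
    · simp [h]
  have hRn : Raux n A (0 + (n - 1)) = 1 := by
    rw [← Matrix.diagonal_one]
    unfold Raux
    congr 1
    ext ⟨k, hk⟩
    have h1 : n - 1 + 1 = n := by omega
    by_cases h : k < n - 1
    · simp [h]
    · have h2 : k = n - 1 := by omega
      simp [h2, h1, hAn]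
  have hS0 : Saux n D 0 = 1 := by
    rw [← Matrix.diagonal_one]
    unfold Saux
    congr 1
    ext ⟨k, hk⟩
    simp [hD0]
  have hSn : Saux n D (0 + (n - 1)) =
      Matrix.diagonal (fun k : Fin n => D (k : ℕ) / D ((k : ℕ) + 1)) := by
    unfold Saux
    congr 1
    ext ⟨k, hk⟩
    have h1 : n - 1 + 1 = n := by omega
    by_cases h : k < n - 1
    · simp [h]
    · have h2 : k = n - 1 := by omega
      simp [h2, h1, hDn]
  rw [hR0, hRn, mul_one] at hR
  rw [hS0, hSn, one_mul] at hS
  simp only [zero_add] at hR hS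
  rw [prod_mul_aux _ _ _ List.nodup_range', ← mul_assoc, hR, mul_assoc, ← hS]
  intro i hi j hj hij
  rw [List.mem_range'_1] at hi hj
  obtain ⟨i, rfl⟩ : ∃ k, i = k + 1 := ⟨i - 1, by omega⟩
  obtain ⟨j, rfl⟩ : ∃ k, j = k + 1 := ⟨j - 1, by omega⟩
  have hc := UL_commute n i j (by omega) (by omega) (by omega)
    (B (i + 1) * (A (i + 1))⁻¹ * A (i + 1 + 1)) (C (j + 1) * D (j + 1) * (D (j + 1 - 1))⁻¹)
  have hdet := Lmat_one_det n j (by omega) (C (j + 1) * D (j + 1) * (D (j + 1 - 1))⁻¹)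
  set T := Lmat n (j + 1) 1 (C (j + 1) * D (j + 1) * (D (j + 1 - 1))⁻¹)
  set V := Umat n (i + 1) 1 (B (i + 1) * (A (i + 1))⁻¹ * A (i + 1 + 1))
  have hT : IsUnit T.det := by rw [hdet]; exact isUnit_one
  change V * T⁻¹ = T⁻¹ * V
  calc V * T⁻¹ = T⁻¹ * (T * V) * T⁻¹ := by
        rw [← mul_assoc, Matrix.nonsing_inv_mul _ hT, one_mul]
    _ = T⁻¹ * V := by
        rw [← hc.eq, mul_assoc, mul_assoc, Matrix.mul_nonsing_inv _ hT, mul_one]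
end

section
/- Fix n ≥ 2 and A_i, D_i ∈ ℂ*, B_i, C_i ∈ ℂ for i = 1,…,n−1. Let T be the diagonal n×n matrix with T_kk = (A_k·D_{k−1})/(A_{k−1}·D_k) (k = 1,…,n, conventions A₀ = D₀ = A_n = D_n = 1). Set V_i = B_i·A_i·A_{i−1}⁻¹ and W_i = C_i·D_i⁻¹·D_{i+1}. Then U_1(A_1,B_1)⋯U_{n−1}(A_{n−1},B_{n−1})·L_1(D_1,C_1)⁻¹⋯L_{n−1}(D_{n−1},C_{n−1})⁻¹ = U_1(1,V_1)⋯U_{n−1}(1,V_{n−1})·T·L_1(1,W_1)⁻¹⋯L_{n−1}(1,W_{n−1})⁻¹. (Second identity of the factorization of U·L⁻¹ on a Coxeter leaf, for SL_n.) -/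
open scoped Matrix

theorem telescope_aux {M : Type*} [Monoid M] (F G Q : ℕ → M) (m : ℕ)
    (h : ∀ i, 1 ≤ i → i ≤ m → F i * Q (i + 1) = Q i * G i) :
    ((List.range' 1 m).map F).prod * Q (m + 1) = Q 1 * ((List.range' 1 m).map G).prod := by
  induction m with
  | zero => simp
  | succ m ih =>
    have ih' := ih (fun i h1 h2 => h i h1 (by omega))
    have hm := h (m + 1) (by omega) le_rfl
    simp only [List.range'_concat, List.map_append, List.prod_append, List.map_cons,
      List.map_nil, List.prod_cons, List.prod_nil, mul_one, one_mul]
    rw [show 1 + m = m + 1 by omega, mul_assoc, hm, ← mul_assoc, ih', mul_assoc]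

theorem Lmat_det_unit (n i : ℕ) (D C : ℂ) (hD : D ≠ 0) : IsUnit (Lmat n i D C).det := by
  rw [Matrix.det_of_isLowerTriangular]
  · rw [isUnit_iff_ne_zero, Finset.prod_ne_zero_iff]
    intro j _
    unfold Lmat
    split_ifs <;> first | omega | exact hD | exact inv_ne_zero hD | simp_all
  · intro j k hjk
    have hjk' : (j : ℕ) < k := hjk
    have hne : j ≠ k := by rintro rfl; omega
    unfold Lmat
    rw [if_neg (by omega), if_neg (by omega), if_neg (by omega), if_neg hne]

/-- Accumulated torus part on the upper side. -/
noncomputable def Pfun (A : ℕ → ℂ) (m k : ℕ) : ℂ :=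
  if k + 1 < m then A (k + 1) / A k else if k + 1 = m then (A k)⁻¹ else 1

/-- Accumulated torus part on the lower side. -/
noncomputable def Qfun (D : ℕ → ℂ) (m k : ℕ) : ℂ :=
  if k + 1 < m then 1 else if k + 1 = m then (D m)⁻¹ else D k / D (k + 1)

theorem U_step (n i : ℕ) (hi : 1 ≤ i) (A B : ℕ → ℂ) (hA : ∀ k, A k ≠ 0) :
    Umat n i 1 (B i * A i * (A (i - 1))⁻¹) *
      Matrix.diagonal (fun k : Fin n => Pfun A (i + 1) k) =
    Matrix.diagonal (fun k : Fin n => Pfun A i k) * Umat n i (A i) (B i) := by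
  obtain ⟨i, rfl⟩ : ∃ j, i = j + 1 := ⟨i - 1, by omega⟩
  ext ⟨j, hj⟩ ⟨k, hk⟩
  rw [Matrix.mul_diagonal, Matrix.diagonal_mul]
  have h1 := hA i
  have h2 := hA (i + 1)
  simp only [Umat, Pfun, Fin.mk.injEq, Nat.add_sub_cancel]
  split_ifs <;> first
    | omega
    | (simp only [zero_mul, mul_zero]; done)
    | (have e1 : j = i := by omega
       have e2 : k = i := by omega
       try rw [e1]
       try rw [e2]
       field_simp; done)
    | (have e1 : j = i := by omega
       have e2 : k = i + 1 := by omega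
       try rw [e1]
       try rw [e2]
       field_simp; done)
    | (have e1 : j = i + 1 := by omega
       have e2 : k = i := by omega
       try rw [e1]
       try rw [e2]
       field_simp; done)
    | (have e1 : j = i + 1 := by omega
       have e2 : k = i + 1 := by omega
       try rw [e1]
       try rw [e2]
       field_simp; done)
    | (have e1 : j = k := by omega
       rw [e1, one_mul, mul_one]; done)
    | (simp only [one_mul, mul_one]; done)
    | (field_simp; done)

theorem L_step (n i : ℕ) (hi : 1 ≤ i) (C D : ℕ → ℂ) (hD : ∀ k, D k ≠ 0) :
    Lmat n i (D i) (C i) * Matrix.diagonal (fun k : Fin n => Qfun D i k) =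
    Matrix.diagonal (fun k : Fin n => Qfun D (i + 1) k) *
      Lmat n i 1 (C i * (D i)⁻¹ * D (i + 1)) := by
  obtain ⟨i, rfl⟩ : ∃ j, i = j + 1 := ⟨i - 1, by omega⟩
  ext ⟨j, hj⟩ ⟨k, hk⟩
  rw [Matrix.mul_diagonal, Matrix.diagonal_mul]
  have h1 := hD i
  have h2 := hD (i + 1)
  have h3 := hD (i + 1 + 1)
  simp only [Lmat, Qfun, Fin.mk.injEq]
  split_ifs <;> first
    | omega
    | (simp only [zero_mul, mul_zero]; done)
    | (have e1 : j = i := by omega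
       have e2 : k = i := by omega
       try rw [e1]
       try rw [e2]
       field_simp; done)
    | (have e1 : j = i := by omega
       have e2 : k = i + 1 := by omega
       try rw [e1]
       try rw [e2]
       field_simp; done)
    | (have e1 : j = i + 1 := by omega
       have e2 : k = i := by omega
       try rw [e1]
       try rw [e2]
       field_simp; done)
    | (have e1 : j = i + 1 := by omega
       have e2 : k = i + 1 := by omega
       try rw [e1]
       try rw [e2]
       field_simp; done)
    | (have e1 : j = k := by omega
       rw [e1, one_mul, mul_one]; done)
    | (simp only [one_mul, mul_one]; done)
    | (field_simp; done)

theorem Linv_step (n i : ℕ) (hi : 1 ≤ i) (C D : ℕ → ℂ) (hD : ∀ k, D k ≠ 0) :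
    (Lmat n i (D i) (C i))⁻¹ * Matrix.diagonal (fun k : Fin n => Qfun D (i + 1) k) =
    Matrix.diagonal (fun k : Fin n => Qfun D i k) *
      (Lmat n i 1 (C i * (D i)⁻¹ * D (i + 1)))⁻¹ := by
  have h := L_step n i hi C D hD
  have u1 := Lmat_det_unit n i (D i) (C i) (hD i)
  have u2 := Lmat_det_unit n i 1 (C i * (D i)⁻¹ * D (i + 1)) one_ne_zero
  generalize Lmat n i (D i) (C i) = X at *
  generalize Lmat n i 1 (C i * (D i)⁻¹ * D (i + 1)) = Y at *
  generalize Matrix.diagonal (fun k : Fin n => Qfun D i k) = P at *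
  generalize Matrix.diagonal (fun k : Fin n => Qfun D (i + 1) k) = Q at *
  calc X⁻¹ * Q = X⁻¹ * (Q * Y) * Y⁻¹ := by
        rw [mul_assoc, mul_assoc, Matrix.mul_nonsing_inv _ u2, mul_one]
    _ = P * Y⁻¹ := by
        rw [← h, ← mul_assoc, Matrix.nonsing_inv_mul _ u1, one_mul]

/-- Second identity of the factorization of `U·L⁻¹` on a Coxeter leaf, for `SL_n`:
`U₁(A₁,B₁)⋯U_{n−1}(A_{n−1},B_{n−1})·L₁(D₁,C₁)⁻¹⋯L_{n−1}(D_{n−1},C_{n−1})⁻¹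
 = U₁(1,V₁)⋯U_{n−1}(1,V_{n−1}) · T · L₁(1,W₁)⁻¹⋯L_{n−1}(1,W_{n−1})⁻¹`
with `Vᵢ = Bᵢ Aᵢ A_{i-1}⁻¹`, `Wᵢ = Cᵢ Dᵢ⁻¹ D_{i+1}` and
`T = diag(A_k·D_{k-1}/(A_{k-1}·D_k))` (conventions `A₀ = D₀ = A_n = D_n = 1`). -/
theorem coxeter_leaf_factorization_second_identity
    (n : ℕ) (hn : 2 ≤ n) (A B C D : ℕ → ℂ)
    (hA : ∀ k, A k ≠ 0) (hD : ∀ k, D k ≠ 0)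
    (hA0 : A 0 = 1) (hAn : A n = 1) (hD0 : D 0 = 1) (hDn : D n = 1) :
    ((List.range' 1 (n - 1)).map (fun i => Umat n i (A i) (B i))).prod *
      ((List.range' 1 (n - 1)).map (fun i => (Lmat n i (D i) (C i))⁻¹)).prod =
    ((List.range' 1 (n - 1)).map (fun i => Umat n i 1 (B i * A i * (A (i - 1))⁻¹))).prod *
      Matrix.diagonal
        (fun k : Fin n => A ((k : ℕ) + 1) * D (k : ℕ) / (A (k : ℕ) * D ((k : ℕ) + 1))) *
      ((List.range' 1 (n - 1)).map
        (fun i => (Lmat n i 1 (C i * (D i)⁻¹ * D (i + 1)))⁻¹)).prod := by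
  have hU := telescope_aux _ _ (fun i => Matrix.diagonal (fun k : Fin n => Pfun A i k)) (n - 1)
    (fun i h1 _ => U_step n i h1 A B hA)
  have hL := telescope_aux _ _ (fun i => Matrix.diagonal (fun k : Fin n => Qfun D i k)) (n - 1)
    (fun i h1 _ => Linv_step n i h1 C D hD)
  have hn1 : n - 1 + 1 = n := by omega
  have e1 : Matrix.diagonal (fun k : Fin n => Pfun A 1 k) = 1 := by
    rw [← Matrix.diagonal_one]
    congr 1
    ext k
    unfold Pfun
    split_ifs with h1 h2
    · omega
    · rw [show (k : ℕ) = 0 by omega, hA0, inv_one]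
    · rfl
  have e2 : Matrix.diagonal (fun k : Fin n => Qfun D n k) = 1 := by
    rw [← Matrix.diagonal_one]
    congr 1
    ext k
    have := k.2
    unfold Qfun
    split_ifs with h1 h2
    · rfl
    · rw [hDn, inv_one]
    · omega
  have e3 : Matrix.diagonal (fun k : Fin n => A ((k : ℕ) + 1) * D (k : ℕ) /
        (A (k : ℕ) * D ((k : ℕ) + 1))) =
      Matrix.diagonal (fun k : Fin n => Pfun A n k) *
        Matrix.diagonal (fun k : Fin n => Qfun D 1 k) := by
    rw [Matrix.diagonal_mul_diagonal]
    congr 1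
    ext k
    have hk := k.2
    have hP : Pfun A n k = A ((k : ℕ) + 1) / A k := by
      unfold Pfun
      split_ifs with h1 h2
      · rfl
      · rw [h2, hAn, one_div]
      · omega
    have hQ : Qfun D 1 k = D k / D ((k : ℕ) + 1) := by
      unfold Qfun
      split_ifs with h1 h2
      · omega
      · rw [show (k : ℕ) = 0 by omega, hD0, one_div]
      · rfl
    rw [hP, hQ, div_mul_div_comm]
  simp only [hn1, e1, e2, one_mul, mul_one] at hU hL
  rw [e3, ← hU, hL]
  simp only [mul_assoc]
end

section
/- Let r ≥ 1, let C : (Fin r)×(Fin r) → ℤ and d : Fin r → ℝ with d_i > 0 and d_i·C_{ij} = d_j·C_{ji}, and fix a linear order ≺ on the index set. With the Poisson bracket {·,·} on differentiable functions of (A,B,C,D) ∈ (ℂ*)^{4r} defined below, the functions χ⁺_i = V_i·W_i, χ⁻_i = χ⁺_i·∏_j (A_j/D_j)^{−C_{ji}}, F_i = A_i·D_i and G_i = (B_i/C_i)·A_i·D_i·∏_{j≻i} A_j^{C_{ji}}·∏_{j≺i} D_j^{C_{ji}} satisfy: {χ⁺_i, χ⁺_j} = 0, {χ⁻_i, χ⁻_j}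 = 0, {χ⁺_i, χ⁻_j} = −2·d_i·C_{ij}·χ⁺_i·χ⁻_j, {χ^±_i, F_j} = 0, {χ^±_i, G_j} = 0, and {F_i, G_j} = −2·d_i·δ_{ij}·F_i·G_j. -/
/-! Coordinates on `(ℂ*)^{4r}`: a point is a function `p : Fin 4 × Fin r → ℂ`, with
`A_i = p (0,i)`, `B_i = p (1,i)`, `C_i = p (2,i)`, `D_i = p (3,i)`. -/

/-- The partial derivative of `f` at `p` in the coordinate direction `u`. -/
noncomputable def pderiv (r : ℕ) (f : ((Fin 4 × Fin r) → ℂ) → ℂ)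
    (p : (Fin 4 × Fin r) → ℂ) (u : Fin 4 × Fin r) : ℂ :=
  fderiv ℂ f p (Pi.single u 1)

/-- The Poisson bracket
`{f,g} = Σ_i d_i·[−A_iB_i(∂_{A_i}f·∂_{B_i}g − ∂_{B_i}f·∂_{A_i}g)
                 + D_iC_i(∂_{D_i}f·∂_{C_i}g − ∂_{C_i}f·∂_{D_i}g)]`. -/
noncomputable def bracket (r : ℕ) (d : Fin r → ℝ) (f g : ((Fin 4 × Fin r) → ℂ) → ℂ)
    (p : (Fin 4 × Fin r) → ℂ) : ℂ :=
  ∑ i : Fin r, (d i : ℂ) *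
    (-(p (0, i) * p (1, i)) *
        (pderiv r f p (0, i) * pderiv r g p (1, i) -
          pderiv r f p (1, i) * pderiv r g p (0, i)) +
      p (3, i) * p (2, i) *
        (pderiv r f p (3, i) * pderiv r g p (2, i) -
          pderiv r f p (2, i) * pderiv r g p (3, i)))

/-- `V_i = B_i·A_i·∏_{j≺i} A_j^{C_ji}`, where `j ≺ i` means `σ j < σ i`. -/
noncomputable def Vfun (r : ℕ) (C : Fin r → Fin r → ℤ) (σ : Equiv.Perm (Fin r))
    (i : Fin r) (p : (Fin 4 × Fin r) → ℂ) : ℂ :=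
  p (1, i) * p (0, i) * ∏ j ∈ Finset.univ.filter (fun j => σ j < σ i), p (0, j) ^ (C j i)

/-- `W_i = C_i·D_i⁻¹·∏_{j≻i} D_j^{−C_ji}`, where `j ≻ i` means `σ i < σ j`. -/
noncomputable def Wfun (r : ℕ) (C : Fin r → Fin r → ℤ) (σ : Equiv.Perm (Fin r))
    (i : Fin r) (p : (Fin 4 × Fin r) → ℂ) : ℂ :=
  p (2, i) * (p (3, i))⁻¹ * ∏ j ∈ Finset.univ.filter (fun j => σ i < σ j), p (3, j) ^ (-(C j i))

/-- `χ⁺_i = V_i·W_i`. -/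
noncomputable def chiP (r : ℕ) (C : Fin r → Fin r → ℤ) (σ : Equiv.Perm (Fin r))
    (i : Fin r) (p : (Fin 4 × Fin r) → ℂ) : ℂ :=
  Vfun r C σ i p * Wfun r C σ i p

/-- `χ⁻_i = χ⁺_i·∏_j (A_j/D_j)^{−C_ji}`. -/
noncomputable def chiM (r : ℕ) (C : Fin r → Fin r → ℤ) (σ : Equiv.Perm (Fin r))
    (i : Fin r) (p : (Fin 4 × Fin r) → ℂ) : ℂ :=
  chiP r C σ i p * ∏ j : Fin r, (p (0, j) / p (3, j)) ^ (-(C j i))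

/-- `F_i = A_i·D_i`. -/
noncomputable def Ffun (r : ℕ) (i : Fin r) (p : (Fin 4 × Fin r) → ℂ) : ℂ :=
  p (0, i) * p (3, i)

/-- `G_i = (B_i/C_i)·A_i·D_i·∏_{j≻i} A_j^{C_ji}·∏_{j≺i} D_j^{C_ji}`. -/
noncomputable def Gfun (r : ℕ) (C : Fin r → Fin r → ℤ) (σ : Equiv.Perm (Fin r))
    (i : Fin r) (p : (Fin 4 × Fin r) → ℂ) : ℂ :=
  p (1, i) / p (2, i) * p (0, i) * p (3, i) *
    (∏ j ∈ Finset.univ.filter (fun j => σ i < σ j), p (0, j) ^ (C j i)) *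
    (∏ j ∈ Finset.univ.filter (fun j => σ j < σ i), p (3, j) ^ (C j i))

/-- `f` is nonzero and differentiable at `p`, with logarithmic partial derivatives `e`. -/
def LD (r : ℕ) (f : ((Fin 4 × Fin r) → ℂ) → ℂ) (p : (Fin 4 × Fin r) → ℂ)
    (e : Fin 4 × Fin r → ℂ) : Prop :=
  f p ≠ 0 ∧ DifferentiableAt ℂ f p ∧ ∀ u, p u * pderiv r f p u = e u * f p

theorem LD.coord {r : ℕ} {p : (Fin 4 × Fin r) → ℂ} (hp : ∀ u, p u ≠ 0) (v : Fin 4 × Fin r) :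
    LD r (fun q => q v) p (fun u => if u = v then 1 else 0) := by
  refine ⟨hp v, by fun_prop, fun u => ?_⟩
  have h : HasFDerivAt (fun q : (Fin 4 × Fin r) → ℂ => q v)
      (ContinuousLinearMap.proj (R := ℂ) (φ := fun _ => ℂ) v) p :=
    (ContinuousLinearMap.proj (R := ℂ) (φ := fun _ : Fin 4 × Fin r => ℂ) v).hasFDerivAt
  unfold pderiv
  rw [h.fderiv]
  simp only [ContinuousLinearMap.proj_apply, Pi.single_apply]
  by_cases huv : u = v
  · subst huv; simp
  · simp [huv, Ne.symm huv]

theorem LD.mul {r : ℕ} {p : (Fin 4 × Fin r) → ℂ} {f g : ((Fin 4 × Fin r) → ℂ) → ℂ}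
    {e e' : Fin 4 × Fin r → ℂ} (hf : LD r f p e) (hg : LD r g p e') :
    LD r (fun q => f q * g q) p (fun u => e u + e' u) := by
  refine ⟨mul_ne_zero hf.1 hg.1, hf.2.1.mul hg.2.1, fun u => ?_⟩
  have h1 := hf.2.2 u
  have h2 := hg.2.2 u
  unfold pderiv at *
  have h3 : fderiv ℂ (fun q => f q * g q) p = _ :=
    (hf.2.1.hasFDerivAt.mul hg.2.1.hasFDerivAt).fderiv
  rw [h3]
  simp only [ContinuousLinearMap.add_apply, smul_apply, smul_eq_mul]
  linear_combination f p * h2 + g p * h1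

theorem LD.zpow {r : ℕ} {p : (Fin 4 × Fin r) → ℂ} {f : ((Fin 4 × Fin r) → ℂ) → ℂ}
    {e : Fin 4 × Fin r → ℂ} (hf : LD r f p e) (n : ℤ) :
    LD r (fun q => f q ^ n) p (fun u => (n : ℂ) * e u) := by
  have hz := (hasDerivAt_zpow n (f p) (Or.inl hf.1)).comp_hasFDerivAt p hf.2.1.hasFDerivAt
  refine ⟨zpow_ne_zero _ hf.1, hz.differentiableAt, fun u => ?_⟩
  have h1 := hf.2.2 u
  unfold pderiv at *
  have : fderiv ℂ (fun q => f q ^ n) p = _ := hz.fderiv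
  rw [this]
  simp only [smul_apply, smul_eq_mul]
  have h3 : f p ^ n = f p ^ (n - 1) * f p := by
    rw [← zpow_add_one₀ hf.1]; simp
  rw [h3]
  linear_combination (n : ℂ) * f p ^ (n - 1) * h1

theorem LD.inv {r : ℕ} {p : (Fin 4 × Fin r) → ℂ} {f : ((Fin 4 × Fin r) → ℂ) → ℂ}
    {e : Fin 4 × Fin r → ℂ} (hf : LD r f p e) :
    LD r (fun q => (f q)⁻¹) p (fun u => - e u) := by
  simpa using hf.zpow (-1)

theorem LD.div {r : ℕ} {p : (Fin 4 × Fin r) → ℂ} {f g : ((Fin 4 × Fin r) → ℂ) → ℂ}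
    {e e' : Fin 4 × Fin r → ℂ} (hf : LD r f p e) (hg : LD r g p e') :
    LD r (fun q => f q / g q) p (fun u => e u + - e' u) := by
  simpa [div_eq_mul_inv] using hf.mul hg.inv

theorem LD.prod {r : ℕ} {p : (Fin 4 × Fin r) → ℂ} {ι : Type*} (s : Finset ι)
    {f : ι → ((Fin 4 × Fin r) → ℂ) → ℂ}
    {e : ι → Fin 4 × Fin r → ℂ} (hf : ∀ j, LD r (f j) p (e j)) :
    LD r (fun q => ∏ j ∈ s, f j q) p (fun u => ∑ j ∈ s, e j u) := by
  classical
  induction s using Finset.induction_on with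
  | empty => exact ⟨by simp, by simp, fun u => by simp [pderiv]⟩
  | insert a s ha ih => simpa [Finset.prod_insert ha, Finset.sum_insert ha] using (hf a).mul ih

/-- Exponent data: `B`- and `C`-exponents supported at `i`. -/
def EX (r : ℕ) (i : Fin r) (β γ : ℂ) (a δ : Fin r → ℂ) (u : Fin 4 × Fin r) : ℂ :=
  if u.1 = 0 then a u.2 else if u.1 = 1 then (if u.2 = i then β else 0)
  else if u.1 = 2 then (if u.2 = i then γ else 0) else δ u.2

theorem LD.congr {r : ℕ} {p : (Fin 4 × Fin r) → ℂ} {f : ((Fin 4 × Fin r) → ℂ) → ℂ}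
    {e e' : Fin 4 × Fin r → ℂ} (hf : LD r f p e) (h : ∀ s k, e (s, k) = e' (s, k)) :
    LD r f p e' := by
  have : e = e' := funext fun ⟨s, k⟩ => h s k
  exact this ▸ hf

theorem bracket_LD {r : ℕ} (d : Fin r → ℝ) {p : (Fin 4 × Fin r) → ℂ}
    {f g : ((Fin 4 × Fin r) → ℂ) → ℂ} {i j : Fin r} {β γ β' γ' : ℂ} {a δ a' δ' : Fin r → ℂ}
    (hf : LD r f p (EX r i β γ a δ)) (hg : LD r g p (EX r j β' γ' a' δ')) :
    bracket r d f g p = (-(d j * β' * a j) + d i * β * a' i + d j * γ' * δ j - d i * γ * δ' i)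
      * f p * g p := by
  have key : ∀ k : Fin r, (d k : ℂ) *
    (-(p (0, k) * p (1, k)) *
        (pderiv r f p (0, k) * pderiv r g p (1, k) -
          pderiv r f p (1, k) * pderiv r g p (0, k)) +
      p (3, k) * p (2, k) *
        (pderiv r f p (3, k) * pderiv r g p (2, k) -
          pderiv r f p (2, k) * pderiv r g p (3, k))) =
      (if k = j then (-(d k * β' * a k) + d k * γ' * δ k) * f p * g p else 0) +
      (if k = i then (d k * β * a' k - d k * γ * δ' k) * f p * g p else 0) := by
    intro k
    have f0 := hf.2.2 (0, k)
    have f1 := hf.2.2 (1, k)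
    have f2 := hf.2.2 (2, k)
    have f3 := hf.2.2 (3, k)
    have g0 := hg.2.2 (0, k)
    have g1 := hg.2.2 (1, k)
    have g2 := hg.2.2 (2, k)
    have g3 := hg.2.2 (3, k)
    have e1 : ∀ x y z w : ℂ, (d k : ℂ) *
      (-(p (0, k) * p (1, k)) *
        (pderiv r f p (0, k) * pderiv r g p (1, k) -
          pderiv r f p (1, k) * pderiv r g p (0, k)) +
      p (3, k) * p (2, k) *
        (pderiv r f p (3, k) * pderiv r g p (2, k) -
          pderiv r f p (2, k) * pderiv r g p (3, k))) = (d k : ℂ) *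
       (-((p (0, k) * pderiv r f p (0, k)) * (p (1, k) * pderiv r g p (1, k)) -
          (p (1, k) * pderiv r f p (1, k)) * (p (0, k) * pderiv r g p (0, k))) +
        ((p (3, k) * pderiv r f p (3, k)) * (p (2, k) * pderiv r g p (2, k)) -
          (p (2, k) * pderiv r f p (2, k)) * (p (3, k) * pderiv r g p (3, k)))) := by
      intros; ring
    rw [e1 0 0 0 0, f0, f1, f2, f3, g0, g1, g2, g3]
    simp only [EX]
    simp
    split_ifs <;> ring
  unfold bracket
  rw [Finset.sum_congr rfl fun k _ => key k, Finset.sum_add_distrib]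
  simp only [Finset.sum_ite_eq', Finset.mem_univ, if_true]
  ring

theorem LD_chiP {r : ℕ} (C : Fin r → Fin r → ℤ) (σ : Equiv.Perm (Fin r))
    {p : (Fin 4 × Fin r) → ℂ} (hp : ∀ u, p u ≠ 0) (i : Fin r) :
    LD r (chiP r C σ i) p (EX r i 1 1
      (fun k => (if k = i then 1 else 0) + if σ k < σ i then (C k i : ℂ) else 0)
      (fun k => -(if k = i then 1 else 0) - if σ i < σ k then (C k i : ℂ) else 0)) := by
  have hc := LD.coord (r := r) hp
  have h := (((hc (1, i)).mul (hc (0, i))).mul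
    (LD.prod (Finset.univ.filter (fun j => σ j < σ i)) fun j => (hc (0, j)).zpow (C j i))).mul
    (((hc (2, i)).mul (hc (3, i)).inv).mul
    (LD.prod (Finset.univ.filter (fun j => σ i < σ j)) fun j => (hc (3, j)).zpow (-(C j i))))
  refine LD.congr (f := chiP r C σ i) h fun s k => ?_
  fin_cases s <;> simp [EX, Prod.ext_iff] <;> (try split_ifs) <;> (try ring)

theorem LD_chiM {r : ℕ} (C : Fin r → Fin r → ℤ) (σ : Equiv.Perm (Fin r))
    {p : (Fin 4 × Fin r) → ℂ} (hp : ∀ u, p u ≠ 0) (i : Fin r) :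
    LD r (chiM r C σ i) p (EX r i 1 1
      (fun k => (if k = i then 1 else 0) + (if σ k < σ i then (C k i : ℂ) else 0) - C k i)
      (fun k => -(if k = i then 1 else 0) - (if σ i < σ k then (C k i : ℂ) else 0) + C k i)) := by
  have hc := LD.coord (r := r) hp
  have h := (LD_chiP C σ hp i).mul
    (LD.prod Finset.univ fun j => ((hc (0, j)).div (hc (3, j))).zpow (-(C j i)))
  refine LD.congr (f := chiM r C σ i) h fun s k => ?_
  fin_cases s <;> simp [EX, Prod.ext_iff] <;> (try ring)

theorem LD_F {r : ℕ} {p : (Fin 4 × Fin r) → ℂ} (hp : ∀ u, p u ≠ 0) (i : Fin r) :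
    LD r (Ffun r i) p (EX r i 0 0
      (fun k => if k = i then 1 else 0) (fun k => if k = i then 1 else 0)) := by
  have hc := LD.coord (r := r) hp
  refine LD.congr (f := Ffun r i) ((hc (0, i)).mul (hc (3, i))) fun s k => ?_
  fin_cases s <;> simp [EX, Prod.ext_iff]

theorem LD_G {r : ℕ} (C : Fin r → Fin r → ℤ) (σ : Equiv.Perm (Fin r))
    {p : (Fin 4 × Fin r) → ℂ} (hp : ∀ u, p u ≠ 0) (i : Fin r) :
    LD r (Gfun r C σ i) p (EX r i 1 (-1)
      (fun k => (if k = i then 1 else 0) + if σ i < σ k then (C k i : ℂ) else 0)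
      (fun k => (if k = i then 1 else 0) + if σ k < σ i then (C k i : ℂ) else 0)) := by
  have hc := LD.coord (r := r) hp
  have h := (((((hc (1, i)).div (hc (2, i))).mul (hc (0, i))).mul (hc (3, i))).mul
    (LD.prod (Finset.univ.filter (fun j => σ i < σ j)) fun j => (hc (0, j)).zpow (C j i))).mul
    (LD.prod (Finset.univ.filter (fun j => σ j < σ i)) fun j => (hc (3, j)).zpow (C j i))
  refine LD.congr (f := Gfun r C σ i) h fun s k => ?_
  fin_cases s <;> simp [EX, Prod.ext_iff] <;> (try split_ifs) <;> (try ring)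

/-- The Poisson brackets of the functions `χ⁺, χ⁻, F, G` on a Coxeter leaf:
`{χ⁺_i,χ⁺_j} = {χ⁻_i,χ⁻_j} = 0`, `{χ⁺_i,χ⁻_j} = −2d_iC_ij·χ⁺_i·χ⁻_j`,
`{χ^±_i,F_j} = {χ^±_i,G_j} = 0`, and `{F_i,G_j} = −2d_i·δ_ij·F_i·G_j`. -/
theorem coxeter_leaf_poisson_brackets
    (r : ℕ) (hr : 1 ≤ r) (C : Fin r → Fin r → ℤ) (d : Fin r → ℝ)
    (hd : ∀ i, 0 < d i) (hsym : ∀ i j, d i * (C i j : ℝ) = d j * (C j i : ℝ))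
    (σ : Equiv.Perm (Fin r))
    (p : (Fin 4 × Fin r) → ℂ) (hp : ∀ u, p u ≠ 0) :
    ∀ i j : Fin r,
      bracket r d (chiP r C σ i) (chiP r C σ j) p = 0 ∧
      bracket r d (chiM r C σ i) (chiM r C σ j) p = 0 ∧
      bracket r d (chiP r C σ i) (chiM r C σ j) p =
        -2 * (d i : ℂ) * (C i j : ℂ) * chiP r C σ i p * chiM r C σ j p ∧
      bracket r d (chiP r C σ i) (Ffun r j) p = 0 ∧
      bracket r d (chiM r C σ i) (Ffun r j) p = 0 ∧
      bracket r d (chiP r C σ i) (Gfun r C σ j) p = 0 ∧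
      bracket r d (chiM r C σ i) (Gfun r C σ j) p = 0 ∧
      bracket r d (Ffun r i) (Gfun r C σ j) p =
        -2 * (d i : ℂ) * (if i = j then 1 else 0) * Ffun r i p * Gfun r C σ j p := by
  intro i j
  have hs : (d i : ℂ) * (C i j : ℂ) = d j * (C j i : ℂ) := by exact_mod_cast hsym i j
  have P := LD_chiP C σ hp
  have M := LD_chiM C σ hp
  have F := LD_F (r := r) hp
  have G := LD_G C σ hp
  rw [bracket_LD d (P i) (P j), bracket_LD d (M i) (M j), bracket_LD d (P i) (M j),
    bracket_LD d (P i) (F j), bracket_LD d (M i) (F j), bracket_LD d (P i) (G j),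
    bracket_LD d (M i) (G j), bracket_LD d (F i) (G j)]
  generalize chiP r C σ i p = x1
  generalize chiP r C σ j p = x2
  generalize chiM r C σ i p = x3
  generalize chiM r C σ j p = x4
  generalize Ffun r i p = x5
  generalize Ffun r j p = x6
  generalize Gfun r C σ j p = x7
  rcases lt_trichotomy (σ i) (σ j) with h | h | h
  · have hn : i ≠ j := fun e => by simp [e] at h
    simp only [h, hn, hn.symm, not_lt_of_gt h, if_true, if_false]
    refine ⟨?_, ?_, ?_, ?_, ?_, ?_, ?_, ?_⟩
    · linear_combination x1 * x2 * hs
    · linear_combination (-x3 * x4) * hs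
    · linear_combination (x1 * x4) * hs
    · ring
    · ring
    · linear_combination (-x1 * x7) * hs
    · linear_combination (-x3 * x7) * hs
    · ring
  · have hn : i = j := σ.injective h
    subst hn
    simp only [lt_irrefl, if_true, if_false]
    refine ⟨?_, ?_, ?_, ?_, ?_, ?_, ?_, ?_⟩ <;> ring
  · have hn : i ≠ j := fun e => by simp [e] at h
    simp only [h, hn, hn.symm, not_lt_of_gt h, if_true, if_false]
    refine ⟨?_, ?_, ?_, ?_, ?_, ?_, ?_, ?_⟩
    · linear_combination x1 * x2 * hs
    · linear_combination (-x3 * x4) * hs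
    · linear_combination (x1 * x4) * hs
    · ring
    · ring
    · linear_combination (x1 * x7) * hs
    · linear_combination (x3 * x7) * hs
    · ring
end

section
/- Fix n ≥ 2 and A_i, B_i, C_i, D_i ∈ ℂ* for i = 1,…,n−1. Let T be the diagonal n×n matrix with T_kk = (A_k·D_{k−1})/(A_{k−1}·D_k), and set χ⁺_i = B_i·C_i·A_i·D_{i+1}/(A_{i−1}·D_i) (conventions A₀ = D₀ = A_n = D_n = 1). Then the matrices U_1(A_1,B_1)⋯U_{n−1}(A_{n−1},B_{n−1})·L_1(D_1,C_1)⁻¹⋯L_{n−1}(D_{n−1},C_{n−1})⁻¹ and T·ḡ_1(χ⁺_1)·ḡ_2(χ⁺_2)⋯ḡ_{n−1}(χ⁺_{n−1}) have the same characteristic polynomial; in particular they have equal traces. (Character formula for the factorization dynamics on the Coxeter leaf of SL_n in the coordinates χ⁺.) -/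
open scoped Matrix

/-- `gbar n i x` is the `n×n` identity matrix except that its `2×2` submatrix in
rows and columns `i, i+1` (1-based indexing, `1 ≤ i ≤ n-1`) is `[[1, x], [−1, 1−x]]`. -/
def gbar (n : ℕ) (i : ℕ) (x : ℂ) : Matrix (Fin n) (Fin n) ℂ := fun j k =>
  if (j : ℕ) + 1 = i ∧ (k : ℕ) + 1 = i then 1
  else if (j : ℕ) + 1 = i ∧ (k : ℕ) = i then x
  else if (j : ℕ) = i ∧ (k : ℕ) + 1 = i then -1
  else if (j : ℕ) = i ∧ (k : ℕ) = i then 1 - x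
  else if j = k then 1 else 0

/-- strictly upper elementary matrix -/
def eUp (n i : ℕ) : Matrix (Fin n) (Fin n) ℂ := fun j k =>
  if (j : ℕ) + 1 = i ∧ (k : ℕ) = i then 1 else 0

/-- strictly lower elementary matrix -/
def eLo (n i : ℕ) : Matrix (Fin n) (Fin n) ℂ := fun j k =>
  if (j : ℕ) = i ∧ (k : ℕ) + 1 = i then 1 else 0

/-- diagonal matrix from a sequence -/
def dg (n : ℕ) (d : ℕ → ℂ) : Matrix (Fin n) (Fin n) ℂ := Matrix.diagonal (fun k : Fin n => d k)

/-- upper unipotent -/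
def xm (n i : ℕ) (b : ℂ) : Matrix (Fin n) (Fin n) ℂ := 1 + b • eUp n i

/-- lower unipotent -/
def ym (n i : ℕ) (c : ℂ) : Matrix (Fin n) (Fin n) ℂ := 1 + c • eLo n i

/-- diagonal sequence with `a` in place `i` and `a⁻¹` in place `i+1` (1-based) -/
noncomputable def hs (i : ℕ) (a : ℂ) : ℕ → ℂ := fun k =>
  if k + 1 = i then a else if k = i then a⁻¹ else 1

/-- accumulated diagonal -/
noncomputable def lam (A : ℕ → ℂ) (m : ℕ) : ℕ → ℂ := fun k =>
  if k < m then A (k + 1) / A k else if k = m then (A m)⁻¹ else 1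

lemma eUp_eLo (n i j : ℕ) (h : i ≠ j) : eUp n i * eLo n j = 0 := by
  ext a b
  simp only [Matrix.mul_apply, eUp, eLo, Matrix.zero_apply]
  apply Finset.sum_eq_zero
  intro k _
  split_ifs <;> simp <;> omega

lemma eLo_eUp (n i j : ℕ) (h : i ≠ j) : eLo n j * eUp n i = 0 := by
  ext a b
  simp only [Matrix.mul_apply, eUp, eLo, Matrix.zero_apply]
  apply Finset.sum_eq_zero
  intro k _
  split_ifs <;> simp <;> omega

lemma eLo_sq (n i : ℕ) : eLo n i * eLo n i = 0 := by
  ext a b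
  simp only [Matrix.mul_apply, eLo, Matrix.zero_apply]
  apply Finset.sum_eq_zero
  intro k _
  split_ifs <;> simp <;> omega

lemma eLo_eUp_self (n i : ℕ) (h1 : 1 ≤ i) (h2 : i ≤ n - 1) (hn : 2 ≤ n) (a b : Fin n) :
    (eLo n i * eUp n i) a b = if (a : ℕ) = i ∧ (b : ℕ) = i then 1 else 0 := by
  simp only [Matrix.mul_apply, eLo, eUp]
  rw [Finset.sum_eq_single (⟨i - 1, by omega⟩ : Fin n)]
  · have : i - 1 + 1 = i := by omega
    simp only [this, and_true, true_and]
    split_ifs <;> first | omega | simp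
  · intro k _ hk
    have : (k : ℕ) + 1 ≠ i := by
      intro h; apply hk; apply Fin.ext; simp; omega
    simp [this]
  · simp

lemma xy_comm (n i j : ℕ) (h : i ≠ j) (b c : ℂ) : Commute (ym n j c) (xm n i b) := by
  unfold Commute SemiconjBy xm ym
  simp only [mul_add, add_mul, mul_one, one_mul, smul_mul_assoc, mul_smul_comm,
    eUp_eLo n i j h, eLo_eUp n i j h, smul_zero, add_zero]
  abel

lemma yy_inv (n i : ℕ) (c : ℂ) : ym n i c * ym n i (-c) = 1 := by
  unfold ym
  simp only [mul_add, add_mul, mul_one, one_mul, smul_mul_assoc, mul_smul_comm,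
    eLo_sq, smul_zero, add_zero, add_assoc]
  rw [← add_smul]
  simp

lemma gbar_eq (n i : ℕ) (h1 : 1 ≤ i) (h2 : i ≤ n - 1) (hn : 2 ≤ n) (x : ℂ) :
    gbar n i x = ym n i (-1) * xm n i x := by
  unfold ym xm
  simp only [mul_add, add_mul, mul_one, one_mul, smul_mul_assoc, mul_smul_comm]
  ext a b
  simp only [gbar, Matrix.add_apply, Matrix.smul_apply, Matrix.one_apply,
    eLo_eUp_self n i h1 h2 hn, smul_eq_mul]
  simp only [eUp, eLo, Fin.ext_iff]
  split_ifs <;> first | omega | ring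

lemma dg_xm (n i : ℕ) (h1 : 1 ≤ i) (d : ℕ → ℂ) (b b' : ℂ) (h : d (i - 1) * b = b' * d i) :
    dg n d * xm n i b = xm n i b' * dg n d := by
  ext j k
  simp only [dg, Matrix.diagonal_mul, Matrix.mul_diagonal, xm, Matrix.add_apply,
    Matrix.smul_apply, Matrix.one_apply, eUp, smul_eq_mul, Fin.ext_iff]
  by_cases hh : (j : ℕ) + 1 = i ∧ (k : ℕ) = i
  · have h3 : (j : ℕ) = i - 1 := by omega
    have h4 : ¬ ((j : ℕ) = k) := by omega
    rw [if_pos hh, if_neg h4, hh.2, h3]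
    linear_combination h
  · rw [if_neg hh]
    by_cases h4 : (j : ℕ) = k
    · simp [h4]
    · simp [h4]

lemma dg_ym (n i : ℕ) (h1 : 1 ≤ i) (d : ℕ → ℂ) (b b' : ℂ) (h : d i * b = b' * d (i - 1)) :
    dg n d * ym n i b = ym n i b' * dg n d := by
  ext j k
  simp only [dg, Matrix.diagonal_mul, Matrix.mul_diagonal, ym, Matrix.add_apply,
    Matrix.smul_apply, Matrix.one_apply, eLo, smul_eq_mul, Fin.ext_iff]
  by_cases hh : (j : ℕ) = i ∧ (k : ℕ) + 1 = i
  · have h3 : (k : ℕ) = i - 1 := by omega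
    have h4 : ¬ ((j : ℕ) = k) := by omega
    rw [if_pos hh, if_neg h4, hh.1, h3]
    linear_combination h
  · rw [if_neg hh]
    by_cases h4 : (j : ℕ) = k
    · simp [h4]
    · simp [h4]

lemma dg_mul (n : ℕ) (d e : ℕ → ℂ) : dg n d * dg n e = dg n (fun k => d k * e k) := by
  simp [dg, Matrix.diagonal_mul_diagonal]

lemma dg_congr (n : ℕ) (d e : ℕ → ℂ) (h : ∀ k, k < n → d k = e k) : dg n d = dg n e := by
  unfold dg
  congr 1
  funext k
  exact h k k.2

lemma dg_one (n : ℕ) (d : ℕ → ℂ) (h : ∀ k, k < n → d k = 1) : dg n d = 1 := by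
  rw [dg_congr n d (fun _ => 1) h]
  simp [dg]

lemma Umat_eq (n i : ℕ) (a b : ℂ) (ha : a ≠ 0) :
    Umat n i a b = xm n i (b * a) * dg n (hs i a) := by
  ext j k
  simp only [dg, Matrix.mul_diagonal, xm, Matrix.add_apply, Umat, hs,
    Matrix.smul_apply, Matrix.one_apply, eUp, smul_eq_mul, Fin.ext_iff]
  split_ifs <;> first | omega | (field_simp; done) | (simp; done) | (simp [ha]; done)

lemma Lmat_eq (n i : ℕ) (a b : ℂ) (ha : a ≠ 0) :
    Lmat n i a b = dg n (hs i a) * ym n i (b * a) := by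
  ext j k
  simp only [dg, Matrix.diagonal_mul, ym, Matrix.add_apply, Lmat, hs,
    Matrix.smul_apply, Matrix.one_apply, eLo, smul_eq_mul, Fin.ext_iff]
  split_ifs <;> first | omega | (rw [zero_add, mul_one]; field_simp; done) | (field_simp; done) | (simp; done) | (simp [ha]; done)

lemma Linv_eq (n i : ℕ) (a b : ℂ) (ha : a ≠ 0) :
    (Lmat n i a b)⁻¹ = ym n i (-(b * a)) * dg n (hs i a⁻¹) := by
  apply Matrix.inv_eq_right_inv
  rw [Lmat_eq n i a b ha]
  rw [show dg n (hs i a) * ym n i (b * a) * (ym n i (-(b * a)) * dg n (hs i a⁻¹))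
    = dg n (hs i a) * (ym n i (b * a) * ym n i (-(b * a))) * dg n (hs i a⁻¹) by
      simp only [mul_assoc]]
  rw [yy_inv, mul_one, dg_mul]
  apply dg_one
  intro k _
  simp only [hs]
  split_ifs <;> simp [ha]

lemma lam_step (n m : ℕ) (A : ℕ → ℂ) (hA : ∀ k, A k ≠ 0) :
    dg n (lam A m) * dg n (hs (m + 1) (A (m + 1))) = dg n (lam A (m + 1)) := by
  rw [dg_mul]
  apply dg_congr
  intro k _
  simp only [lam, hs]
  rcases lt_trichotomy k m with h | h | h
  · have h1 : ¬ k + 1 = m + 1 := by omega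
    have h3 : ¬ k = m + 1 := by omega
    have h4 : k < m + 1 := by omega
    rw [if_pos h, if_neg h1, if_neg h3, if_pos h4, mul_one]
  · subst h
    simp [div_eq_mul_inv, mul_comm]
  · have h1 : ¬ k < m := by omega
    have h3 : ¬ k = m := by omega
    have h4 : ¬ k < m + 1 := by omega
    simp only [h1, h3, h4, if_false, Nat.add_right_cancel_iff, one_mul]

lemma Uprod (n m : ℕ) (A B : ℕ → ℂ) (hA : ∀ k, A k ≠ 0) (hA0 : A 0 = 1) :
    ((List.range' 1 m).map (fun i => Umat n i (A i) (B i))).prod =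
    ((List.range' 1 m).map (fun i => xm n i (B i * A i / A (i - 1)))).prod * dg n (lam A m) := by
  induction m with
  | zero =>
    rw [dg_one]
    · simp
    · intro k _
      simp [lam, hA0]
  | succ m ih =>
    rw [List.range'_1_concat, List.map_append, List.map_append, List.prod_append,
      List.prod_append, ih]
    simp only [List.map_cons, List.map_nil, List.prod_cons, List.prod_nil, mul_one]
    rw [Umat_eq n _ _ _ (hA _), mul_assoc, ← mul_assoc (dg n _),
      dg_xm n (1 + m) (by omega) (lam A m) (B (1 + m) * A (1 + m))
        (B (1 + m) * A (1 + m) / A (1 + m - 1)), mul_assoc (xm n _ _), add_comm 1 m,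
      lam_step n m A hA, ← mul_assoc]
    have : 1 + m - 1 = m := by omega
    simp [lam, this, div_eq_mul_inv, mul_comm]

lemma Lprod (n m : ℕ) (D C : ℕ → ℂ) (hD : ∀ k, D k ≠ 0) (hD0 : D 0 = 1) :
    ((List.range' 1 m).map (fun i => (Lmat n i (D i) (C i))⁻¹)).prod =
    ((List.range' 1 m).map (fun i => ym n i (-(C i * D i) / D (i - 1)))).prod *
      dg n (lam (fun k => (D k)⁻¹) m) := by
  induction m with
  | zero =>
    rw [dg_one]
    · simp
    · intro k _
      simp [lam, hD0]
  | succ m ih =>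
    rw [List.range'_1_concat, List.map_append, List.map_append, List.prod_append,
      List.prod_append, ih]
    simp only [List.map_cons, List.map_nil, List.prod_cons, List.prod_nil, mul_one]
    rw [Linv_eq n _ _ _ (hD _), mul_assoc, ← mul_assoc (dg n _),
      dg_ym n (1 + m) (by omega) (lam (fun k => (D k)⁻¹) m) (-(C (1 + m) * D (1 + m)))
        (-(C (1 + m) * D (1 + m)) / D (1 + m - 1)), mul_assoc (ym n _ _), add_comm 1 m,
      lam_step n m (fun k => (D k)⁻¹) (fun k => inv_ne_zero (hD k)), ← mul_assoc]
    have : 1 + m - 1 = m := by omega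
    have := hD m
    simp [lam, *]

lemma interlace (n m : ℕ) (b c : ℕ → ℂ) :
    ((List.range' 1 m).map (fun i => ym n i (c i))).prod *
      ((List.range' 1 m).map (fun i => xm n i (b i))).prod =
    ((List.range' 1 m).map (fun i => ym n i (c i) * xm n i (b i))).prod := by
  induction m with
  | zero => simp
  | succ m ih =>
    rw [List.range'_1_concat]
    simp only [List.map_append, List.prod_append, ← ih, List.map_cons, List.map_nil,
      List.prod_cons, List.prod_nil, mul_one]
    have hc : Commute (ym n (1 + m) (c (1 + m)))
        ((List.range' 1 m).map (fun i => xm n i (b i))).prod := by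
      apply Commute.list_prod_right
      intro x hx
      obtain ⟨i, hi, rfl⟩ := List.mem_map.1 hx
      apply xy_comm
      have := (List.mem_range'_1.1 hi).2
      omega
    rw [mul_assoc, ← mul_assoc (ym n _ _), hc.eq]
    simp only [mul_assoc]

lemma conj_list {R : Type*} [Monoid R] (M : R) (f g : ℕ → R) (l : List ℕ)
    (h : ∀ i ∈ l, M * f i = g i * M) : M * (l.map f).prod = (l.map g).prod * M := by
  induction l with
  | nil => simp
  | cons a l ih =>
    simp only [List.map_cons, List.prod_cons]
    rw [← mul_assoc, h a (by simp), mul_assoc, ih (fun i hi => h i (by simp [hi])), mul_assoc]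

lemma main_charpoly
    (n : ℕ) (hn : 2 ≤ n) (A B C D : ℕ → ℂ)
    (hA : ∀ k, A k ≠ 0)
    (hC : ∀ k, 1 ≤ k → k ≤ n - 1 → C k ≠ 0) (hD : ∀ k, D k ≠ 0)
    (hA0 : A 0 = 1) (hAn : A n = 1) (hD0 : D 0 = 1) (hDn : D n = 1) :
    (((List.range' 1 (n - 1)).map (fun i => Umat n i (A i) (B i))).prod *
        ((List.range' 1 (n - 1)).map (fun i => (Lmat n i (D i) (C i))⁻¹)).prod).charpoly =
      (Matrix.diagonal
          (fun k : Fin n => A ((k : ℕ) + 1) * D (k : ℕ) / (A (k : ℕ) * D ((k : ℕ) + 1))) *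
        ((List.range' 1 (n - 1)).map
          (fun i => gbar n i (B i * C i * A i * D (i + 1) / (A (i - 1) * D i)))).prod).charpoly := by
  have hlam : ∀ A : ℕ → ℂ, A n = 1 →
      dg n (lam A (n - 1)) = dg n (fun k => A (k + 1) / A k) := by
    intro A hAn
    apply dg_congr
    intro k hk
    simp only [lam]
    by_cases h : k < n - 1
    · rw [if_pos h]
    · have h2 : k = n - 1 := by omega
      have h3 : n - 1 + 1 = n := by omega
      subst h2
      simp [h3, hAn]
  rw [Uprod n _ A B hA hA0, Lprod n _ D C hD hD0, hlam A hAn, hlam _ (by simp [hDn])]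
  set X := ((List.range' 1 (n - 1)).map (fun i => xm n i (B i * A i / A (i - 1)))).prod with hX
  set Y := ((List.range' 1 (n - 1)).map (fun i => ym n i (-(C i * D i) / D (i - 1)))).prod with hY
  set LA := dg n (fun k => A (k + 1) / A k) with hLA
  set LD := dg n (fun k => (D (k + 1))⁻¹ / (D k)⁻¹) with hLD
  have hYc : LD * ((List.range' 1 (n - 1)).map (fun i => ym n i (-(C i * D (i + 1)) / D i))).prod
      = Y * LD := by
    apply conj_list
    intro i hi
    have hi1 := (List.mem_range'_1.1 hi).1
    apply dg_ym n i hi1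
    have h3 : i - 1 + 1 = i := by omega
    rw [h3]
    have e1 := hD i
    have e2 := hD (i - 1)
    have e3 := hD (i + 1)
    field_simp
  have hT : (Matrix.diagonal
      (fun k : Fin n => A ((k : ℕ) + 1) * D (k : ℕ) / (A (k : ℕ) * D ((k : ℕ) + 1)))) = LA * LD := by
    rw [hLA, hLD, dg_mul]
    unfold dg
    congr 1
    funext k
    have e1 := hA k
    have e2 := hD k
    have e3 := hD (k + 1)
    field_simp
  rw [hT, ← mul_assoc, Matrix.charpoly_mul_comm]
  rw [show LD * (X * LA * Y) = LD * X * (LA * Y) by simp only [mul_assoc],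
    Matrix.charpoly_mul_comm,
    show LA * Y * (LD * X) = LA * (Y * LD) * X by simp only [mul_assoc], ← hYc,
    show ∀ Z, LA * (LD * Z) * X = LA * LD * (Z * X) by intro Z; simp only [mul_assoc],
    interlace n (n - 1) (fun i => B i * A i / A (i - 1)) (fun i => -(C i * D (i + 1)) / D i)]
  let s : ℕ → ℂ := fun k => ∏ j ∈ Finset.range k, (D (j + 1) / (C (j + 1) * D (j + 2)))
  have hs0 : ∀ k, k < n → s k ≠ 0 := by
    intro k hk
    apply Finset.prod_ne_zero_iff.2
    intro j hj
    have := Finset.mem_range.1 hj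
    exact div_ne_zero (hD _) (mul_ne_zero (hC _ (by omega) (by omega)) (hD _))
  have hconj : dg n s * ((List.range' 1 (n - 1)).map (fun i => ym n i (-(C i * D (i + 1)) / D i) *
        xm n i (B i * A i / A (i - 1)))).prod =
      ((List.range' 1 (n - 1)).map
          (fun i => gbar n i (B i * C i * A i * D (i + 1) / (A (i - 1) * D i)))).prod * dg n s := by
    apply conj_list
    intro i hi
    have hi' := List.mem_range'_1.1 hi
    have hC' := hC i hi'.1 (by omega)
    obtain ⟨i, rfl⟩ : ∃ j, i = j + 1 := ⟨i - 1, by omega⟩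
    have hss : s (i + 1) = s i * (D (i + 1) / (C (i + 1) * D (i + 2))) := Finset.prod_range_succ _ _
    have e1 := hD (i + 1)
    have e2 := hD (i + 2)
    have e3 := hA i
    rw [gbar_eq n _ hi'.1 (by omega) hn, ← mul_assoc,
      dg_ym n (i + 1) (by omega) s _ (-1), mul_assoc,
      dg_xm n (i + 1) (by omega) s _
        (B (i + 1) * C (i + 1) * A (i + 1) * D (i + 1 + 1) / (A (i + 1 - 1) * D (i + 1)))]
    · simp only [mul_assoc]
    · simp only [Nat.add_sub_cancel, hss]
      field_simp
    · simp only [Nat.add_sub_cancel, hss]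
      field_simp
  set G := ((List.range' 1 (n - 1)).map
          (fun i => gbar n i (B i * C i * A i * D (i + 1) / (A (i - 1) * D i)))).prod with hG
  set W := ((List.range' 1 (n - 1)).map (fun i => ym n i (-(C i * D (i + 1)) / D i) *
        xm n i (B i * A i / A (i - 1)))).prod with hW
  have hinv : dg n (fun k => (s k)⁻¹) * dg n s = 1 := by
    rw [dg_mul]
    exact dg_one _ _ (fun k hk => inv_mul_cancel₀ (hs0 k hk))
  have hinv' : dg n s * dg n (fun k => (s k)⁻¹) = 1 := by
    rw [dg_mul]
    exact dg_one _ _ (fun k hk => mul_inv_cancel₀ (hs0 k hk))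
  have hcomm : dg n s * (LA * LD) = LA * LD * dg n s := by
    rw [hLA, hLD, dg_mul, dg_mul, dg_mul]
    apply dg_congr
    intro k _
    ring
  calc (LA * LD * W).charpoly
      = (dg n (fun k => (s k)⁻¹) * (dg n s * (LA * LD * W))).charpoly := by
        rw [← mul_assoc (dg n _) (dg n _), hinv, one_mul]
    _ = (LA * LD * G).charpoly := by
        rw [Matrix.charpoly_mul_comm, ← mul_assoc (dg n s), hcomm, mul_assoc (LA * LD), hconj,
          mul_assoc, mul_assoc G, hinv', mul_one]

/-- Character formula for the factorization dynamics on the Coxeter leaf of `SL_n` in the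
coordinates `χ⁺`: the matrices `U₁(A₁,B₁)⋯U_{n−1}·L₁(D₁,C₁)⁻¹⋯L_{n−1}⁻¹` and
`T·ḡ₁(χ⁺₁)⋯ḡ_{n−1}(χ⁺_{n−1})` have the same characteristic polynomial, in particular
equal traces; here `T = diag(A_k·D_{k-1}/(A_{k-1}·D_k))` and
`χ⁺ᵢ = Bᵢ·Cᵢ·Aᵢ·D_{i+1}/(A_{i-1}·Dᵢ)` (conventions `A₀ = D₀ = A_n = D_n = 1`). -/
theorem character_formula_coxeter_leaf
    (n : ℕ) (hn : 2 ≤ n) (A B C D : ℕ → ℂ)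
    (hA : ∀ k, A k ≠ 0) (hB : ∀ k, 1 ≤ k → k ≤ n - 1 → B k ≠ 0)
    (hC : ∀ k, 1 ≤ k → k ≤ n - 1 → C k ≠ 0) (hD : ∀ k, D k ≠ 0)
    (hA0 : A 0 = 1) (hAn : A n = 1) (hD0 : D 0 = 1) (hDn : D n = 1) :
    (((List.range' 1 (n - 1)).map (fun i => Umat n i (A i) (B i))).prod *
        ((List.range' 1 (n - 1)).map (fun i => (Lmat n i (D i) (C i))⁻¹)).prod).charpoly =
      (Matrix.diagonal
          (fun k : Fin n => A ((k : ℕ) + 1) * D (k : ℕ) / (A (k : ℕ) * D ((k : ℕ) + 1))) *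
        ((List.range' 1 (n - 1)).map
          (fun i => gbar n i (B i * C i * A i * D (i + 1) / (A (i - 1) * D i)))).prod).charpoly ∧
    (((List.range' 1 (n - 1)).map (fun i => Umat n i (A i) (B i))).prod *
        ((List.range' 1 (n - 1)).map (fun i => (Lmat n i (D i) (C i))⁻¹)).prod).trace =
      (Matrix.diagonal
          (fun k : Fin n => A ((k : ℕ) + 1) * D (k : ℕ) / (A (k : ℕ) * D ((k : ℕ) + 1))) *
        ((List.range' 1 (n - 1)).map
          (fun i => gbar n i (B i * C i * A i * D (i + 1) / (A (i - 1) * D i)))).prod).trace := by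
  have h := main_charpoly n hn A B C D hA hC hD hA0 hAn hD0 hDn
  refine ⟨h, ?_⟩
  haveI : Nonempty (Fin n) := ⟨⟨0, by omega⟩⟩
  rw [Matrix.trace_eq_neg_charpoly_coeff, Matrix.trace_eq_neg_charpoly_coeff, h]
end

section
/- Fix n ≥ 2, let χ⁺_i ∈ ℂ* and χ⁻_i ∈ ℂ \ {0,1} for i = 1,…,n−1, and let D be an invertible diagonal n×n complex matrix with D_kk/D_{k+1,k+1} = χ⁺_k/χ⁻_k for all k. Define the diagonal matrix D̄ by D̄_kk = D_kk·(1−χ⁻_k)/(1−χ⁻_{k−1}), with the conventions χ⁻_0 = χ⁻_n = 0. Then the matrices D̄·ḡ_1(χ⁻_1)⋯ḡ_{n−1}(χ⁻_{n−1}) and D·ḡ_1(χ⁺_1)⋯ḡ_{n−1}(χ⁺_{n−1}) have the same characteristic polynomial; in particular equal traces. (Invariance of the characters Ch_V under the factorization map α, specialized to SL_n: the pair (D̄, χ⁻) represents the α-image α(χ⁺_i) = χ⁻_i, α(χ⁻_i) = (χ⁻_i)²/χ⁺_i·∏_j(1−χ⁻_j)^{−C_{ji}} of (D, χ⁺).)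 -/
open scoped Matrix

/-- Matrix unit with natural-number (0-based) indices. -/
def eU (n a b : ℕ) : Matrix (Fin n) (Fin n) ℂ := fun j k =>
  if (j : ℕ) = a ∧ (k : ℕ) = b then 1 else 0

/-- Weighted superdiagonal, truncated. -/
def supU (n r : ℕ) (x : ℕ → ℂ) : Matrix (Fin n) (Fin n) ℂ := fun j k =>
  if (j : ℕ) + 1 = k ∧ (k : ℕ) ≤ r then x k else 0

/-- Subdiagonal, truncated. -/
def subN (n r : ℕ) : Matrix (Fin n) (Fin n) ℂ := fun j k =>
  if (j : ℕ) = k + 1 ∧ (j : ℕ) ≤ r then 1 else 0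

lemma eU_mul (n a b : ℕ) (hb : b < n) (M : Matrix (Fin n) (Fin n) ℂ) (j k : Fin n) :
    (eU n a b * M) j k = if (j : ℕ) = a then M ⟨b, hb⟩ k else 0 := by
  rw [Matrix.mul_apply, Finset.sum_eq_single ⟨b, hb⟩]
  · simp [eU]
  · intro l _ hl
    have : (l : ℕ) ≠ b := fun h => hl (Fin.ext h)
    simp [eU, this]
  · simp

lemma gbar_eq_s7 (n r : ℕ) (hr : r + 1 < n) (x : ℂ) :
    gbar n (r + 1) x = (1 - eU n (r + 1) r) * (1 + x • eU n r (r + 1)) := by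
  have h : (1 - eU n (r + 1) r) * (1 + x • eU n r (r + 1))
      = 1 + x • eU n r (r + 1) - eU n (r + 1) r - x • (eU n (r + 1) r * eU n r (r + 1)) := by
    rw [sub_mul, one_mul, mul_add, mul_one, mul_smul_comm]; abel
  rw [h]
  ext j k
  simp only [Matrix.sub_apply, Matrix.add_apply, Matrix.smul_apply,
    eU_mul n (r + 1) r (by omega), Matrix.one_apply, smul_eq_mul]
  simp only [gbar, eU, Fin.ext_iff]
  split_ifs <;> first | omega | simp_all

lemma gbar_mul_e (n i r : ℕ) (hi : i < r) (hr : r + 1 < n) (x : ℂ) :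
    gbar n (i + 1) x * eU n (r + 1) r = eU n (r + 1) r := by
  rw [gbar_eq_s7 n i (by omega)]
  have h1 : eU n i (i + 1) * eU n (r + 1) r = 0 := by
    ext j k
    rw [eU_mul n _ _ (by omega)]
    simp [eU]; omega
  have h2 : eU n (i + 1) i * eU n (r + 1) r = 0 := by
    ext j k
    rw [eU_mul n _ _ (by omega)]
    simp [eU]; omega
  rw [mul_assoc, add_mul, one_mul, smul_mul_assoc, h1, smul_zero, add_zero, sub_mul, one_mul, h2,
    sub_zero]

lemma gbar_mul_B (n r : ℕ) (hr : r + 1 < n) (x : ℕ → ℂ) :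
    gbar n (r + 1) (x (r + 1)) * (1 - supU n (r + 1) x) = 1 - supU n r x - eU n (r + 1) r := by
  have h0 : supU n (r + 1) x = supU n r x + x (r + 1) • eU n r (r + 1) := by
    ext j k
    simp only [Matrix.add_apply, Matrix.smul_apply, supU, eU, smul_eq_mul]
    split_ifs <;> first | omega | simp_all
  have h1 : eU n r (r + 1) * supU n r x = 0 := by
    ext j k
    rw [eU_mul n _ _ (by omega)]
    simp [supU]; omega
  have h2 : eU n r (r + 1) * eU n r (r + 1) = 0 := by
    ext j k
    rw [eU_mul n _ _ (by omega)]
    simp [eU]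
  have h3 : eU n (r + 1) r * supU n r x = 0 := by
    ext j k
    rw [eU_mul n _ _ (by omega)]
    simp [supU]; omega
  have h4 : (1 + x (r + 1) • eU n r (r + 1)) * (1 - supU n (r + 1) x) = 1 - supU n r x := by
    rw [h0]
    simp only [add_mul, mul_sub, mul_add, one_mul, mul_one, smul_mul_assoc, mul_smul_comm, h1, h2,
      smul_zero, add_zero]
    abel
  rw [gbar_eq_s7 n r hr, mul_assoc, h4, sub_mul, one_mul, mul_sub, mul_one, h3, sub_zero]

lemma prod_mul_B (n r : ℕ) (hr : r < n) (x : ℕ → ℂ) :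
    ((List.range' 1 r).map (fun i => gbar n i (x i))).prod * (1 - supU n r x)
      = 1 - subN n r := by
  induction r with
  | zero =>
    simp only [List.range'_zero, List.map_nil, List.prod_nil, one_mul]
    congr 1
    ext j k
    simp only [supU, subN]
    split_ifs <;> first | omega | rfl
  | succ r ih =>
    have key : ∀ s, s ≤ r → ((List.range' 1 s).map (fun i => gbar n i (x i))).prod * eU n (r + 1) r
        = eU n (r + 1) r := by
      intro s hs
      induction s with
      | zero => simp
      | succ s ihs =>
        rw [List.range'_1_concat, List.map_append, List.prod_append]
        simp only [List.map_cons, List.map_nil, List.prod_cons, List.prod_nil, mul_one]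
        rw [mul_assoc, add_comm 1 s, gbar_mul_e n s r (by omega) hr, ihs (by omega)]
    rw [List.range'_1_concat, List.map_append, List.prod_append]
    simp only [List.map_cons, List.map_nil, List.prod_cons, List.prod_nil, mul_one]
    rw [mul_assoc, add_comm 1 r, gbar_mul_B n r hr, mul_sub, ih (by omega), key r le_rfl]
    ext j k
    simp only [Matrix.sub_apply, subN, eU]
    split_ifs <;> first | omega | simp_all

lemma det_B (n r : ℕ) (x : ℕ → ℂ) : (1 - supU n r x).det = 1 := by
  rw [Matrix.det_of_upperTriangular]
  · apply Finset.prod_eq_one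
    intro i _
    simp [supU]
  · intro i j hij
    have h : (j : ℕ) < i := hij
    have h' : i ≠ j := fun e => by simp [e] at h
    simp [supU, Matrix.one_apply, h']
    omega

lemma N_mul_U (n : ℕ) (x : ℕ → ℂ) (h0 : x 0 = 0) :
    subN n (n - 1) * supU n (n - 1) x = Matrix.diagonal (fun k : Fin n => x k) := by
  ext j k
  rw [Matrix.mul_apply, Matrix.diagonal_apply]
  obtain ⟨j, hj⟩ := j
  rcases j with _ | j
  · rw [Finset.sum_eq_zero (fun l _ => by simp [subN])]
    simp [h0]
  · rw [Finset.sum_eq_single ⟨j, by omega⟩]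
    · obtain ⟨k, hk⟩ := k
      simp only [subN, supU, Fin.ext_iff]
      split_ifs <;> first | omega | simp_all
    · intro l _ hl
      have : j ≠ (l : ℕ) := fun h => hl (Fin.ext h.symm)
      simp [subN, this]
    · simp

lemma U_mul_N (n : ℕ) (x : ℕ → ℂ) (h0 : x n = 0) :
    supU n (n - 1) x * subN n (n - 1) = Matrix.diagonal (fun k : Fin n => x (k + 1)) := by
  ext j k
  rw [Matrix.mul_apply, Matrix.diagonal_apply]
  obtain ⟨j, hj⟩ := j
  by_cases hjn : j + 1 < n
  · rw [Finset.sum_eq_single ⟨j + 1, hjn⟩]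
    · obtain ⟨k, hk⟩ := k
      simp only [subN, supU, Fin.ext_iff]
      split_ifs <;> first | omega | (simp_all; done) | (exfalso; simp_all; omega)
    · intro l _ hl
      have : j + 1 ≠ (l : ℕ) := fun h => hl (Fin.ext h.symm)
      simp [supU, this]
    · simp
  · have e : j + 1 = n := by omega
    rw [Finset.sum_eq_zero]
    · simp [e, h0]
    · intro l _
      have : j + 1 ≠ (l : ℕ) := by omega
      simp [supU, this]

lemma AKB (n : ℕ) (m : ℕ → ℂ) (hm : ∀ i, i ≤ n → 1 - m i ≠ 0) (h0 : m 0 = 0) (hn : m n = 0) :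
    (1 - subN n (n - 1)) * Matrix.diagonal (fun k : Fin n => (1 - m (k + 1))⁻¹) *
        (1 - supU n (n - 1) m) =
      (1 - supU n (n - 1) m) * Matrix.diagonal (fun k : Fin n => (1 - m k)⁻¹) *
        (1 - subN n (n - 1)) := by
  set N := subN n (n - 1) with hN
  set U := supU n (n - 1) m with hU
  set K := Matrix.diagonal (fun k : Fin n => (1 - m (k + 1))⁻¹) with hK
  set K' := Matrix.diagonal (fun k : Fin n => (1 - m k)⁻¹) with hK'
  have a1 : N * K = K' * N := by
    ext j k
    rw [hK, hK', Matrix.mul_diagonal, Matrix.diagonal_mul, hN]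
    simp only [subN]
    split_ifs with h
    · rw [h.1]; ring
    · simp
  have a2 : K * U = U * K' := by
    ext j k
    rw [hK, hK', Matrix.mul_diagonal, Matrix.diagonal_mul, hU]
    simp only [supU]
    split_ifs with h
    · rw [h.1]; ring
    · simp
  have a3 : K + K' * (N * U) = K' + K * (U * N) := by
    rw [N_mul_U n m h0, U_mul_N n m hn, hK, hK', Matrix.diagonal_mul_diagonal,
      Matrix.diagonal_mul_diagonal, Matrix.diagonal_add, Matrix.diagonal_add]
    congr 1
    funext k
    have b1 := hm k (by omega)
    have b2 := hm (k + 1) (by omega)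
    field_simp
    ring
  calc (1 - N) * K * (1 - U) = (K + N * K * U) - N * K - K * U := by noncomm_ring
    _ = (K + K' * (N * U)) - K' * N - U * K' := by rw [a1, a2, mul_assoc]
    _ = (K' + K * U * N) - K' * N - U * K' := by rw [a3, mul_assoc]
    _ = (1 - U) * K' * (1 - N) := by rw [a2]; noncomm_ring

/-- Invariance of the characters `Ch_V` under the factorization map `α`, specialized to
`SL_n`: for `χ⁺_i ≠ 0`, `χ⁻_i ∉ {0,1}` (`i = 1,…,n−1`, conventions `χ⁻_0 = χ⁻_n = 0`) and
`D = diag(d)` invertible with `d_k/d_{k+1} = χ⁺_k/χ⁻_k`, the matrix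
`D̄·ḡ₁(χ⁻₁)⋯ḡ_{n−1}(χ⁻_{n−1})`, where `D̄_kk = D_kk·(1−χ⁻_k)/(1−χ⁻_{k−1})`, has the same
characteristic polynomial (in particular the same trace) as `D·ḡ₁(χ⁺₁)⋯ḡ_{n−1}(χ⁺_{n−1})`. -/
theorem characters_invariant_under_factorization_map
    (n : ℕ) (hn : 2 ≤ n) (χp χm : ℕ → ℂ)
    (hχp : ∀ i, 1 ≤ i → i ≤ n - 1 → χp i ≠ 0)
    (hχm0 : ∀ i, 1 ≤ i → i ≤ n - 1 → χm i ≠ 0)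
    (hχm1 : ∀ i, 1 ≤ i → i ≤ n - 1 → χm i ≠ 1)
    (hconv0 : χm 0 = 0) (hconvn : χm n = 0)
    (d : Fin n → ℂ) (hd : ∀ k, d k ≠ 0)
    (hratio : ∀ k, (hk1 : 1 ≤ k) → (hk2 : k ≤ n - 1) →
      d ⟨k - 1, by omega⟩ / d ⟨k, by omega⟩ = χp k / χm k) :
    (Matrix.diagonal (fun k : Fin n => d k * (1 - χm ((k : ℕ) + 1)) / (1 - χm (k : ℕ))) *
        ((List.range' 1 (n - 1)).map (fun i => gbar n i (χm i))).prod).charpoly =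
      (Matrix.diagonal d *
        ((List.range' 1 (n - 1)).map (fun i => gbar n i (χp i))).prod).charpoly ∧
    (Matrix.diagonal (fun k : Fin n => d k * (1 - χm ((k : ℕ) + 1)) / (1 - χm (k : ℕ))) *
        ((List.range' 1 (n - 1)).map (fun i => gbar n i (χm i))).prod).trace =
      (Matrix.diagonal d *
        ((List.range' 1 (n - 1)).map (fun i => gbar n i (χp i))).prod).trace := by
  have hm : ∀ i, i ≤ n → 1 - χm i ≠ 0 := by
    intro i hi h
    have h1 : χm i = 1 := (sub_eq_zero.mp h).symm
    rcases Nat.eq_zero_or_pos i with e | e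
    · rw [e, hconv0] at h1; exact zero_ne_one h1
    · by_cases e' : i = n
      · rw [e', hconvn] at h1; exact zero_ne_one h1
      · exact hχm1 i e (by omega) h1
  have hcp : (Matrix.diagonal (fun k : Fin n => d k * (1 - χm ((k : ℕ) + 1)) / (1 - χm (k : ℕ))) *
        ((List.range' 1 (n - 1)).map (fun i => gbar n i (χm i))).prod).charpoly =
      (Matrix.diagonal d *
        ((List.range' 1 (n - 1)).map (fun i => gbar n i (χp i))).prod).charpoly := by
    have hPm := prod_mul_B n (n - 1) (by omega) χm
    have hPp := prod_mul_B n (n - 1) (by omega) χp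
    have hAKB := AKB n χm hm hconv0 hconvn
    have hdm := det_B n (n - 1) χm
    have hdp := det_B n (n - 1) χp
    have hBD : (1 - supU n (n - 1) χp) * Matrix.diagonal d
        = Matrix.diagonal d * (1 - supU n (n - 1) χm) := by
      rw [sub_mul, mul_sub, one_mul, mul_one]
      congr 1
      ext j k
      rw [Matrix.mul_diagonal, Matrix.diagonal_mul]
      simp only [supU]
      split_ifs with h
      · obtain ⟨j, hj⟩ := j
        obtain ⟨k, hk⟩ := k
        simp only at h
        obtain ⟨rfl, h2⟩ := h
        have := hratio (j + 1) (by omega) h2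
        have c1 := hd ⟨j + 1, hk⟩
        have c2 := hχm0 (j + 1) (by omega) h2
        simp only [Nat.add_sub_cancel] at this
        rw [div_eq_div_iff c1 c2] at this
        exact this.symm
      · simp
    generalize ((List.range' 1 (n - 1)).map (fun i => gbar n i (χm i))).prod = Pm at *
    generalize ((List.range' 1 (n - 1)).map (fun i => gbar n i (χp i))).prod = Pp at *
    generalize 1 - supU n (n - 1) χm = B at *
    generalize 1 - supU n (n - 1) χp = B' at *
    generalize 1 - subN n (n - 1) = A at *
    have uB : IsUnit B.det := by rw [hdm]; exact isUnit_one
    have uB' : IsUnit B'.det := by rw [hdp]; exact isUnit_one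
    have ePm : Pm = A * B⁻¹ := by rw [← hPm, Matrix.mul_nonsing_inv_cancel_right _ _ uB]
    have ePp : Pp = A * B'⁻¹ := by rw [← hPp, Matrix.mul_nonsing_inv_cancel_right _ _ uB']
    set D := Matrix.diagonal d with hD
    set K := Matrix.diagonal (fun k : Fin n => (1 - χm (k + 1))⁻¹) with hK
    set K' := Matrix.diagonal (fun k : Fin n => (1 - χm k)⁻¹) with hK'
    set L := Matrix.diagonal (fun k : Fin n => (1 - χm (k + 1))) with hL
    have hKL : K * L = 1 := by
      rw [hK, hL, Matrix.diagonal_mul_diagonal, ← Matrix.diagonal_one]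
      congr 1
      funext k
      exact inv_mul_cancel₀ (hm _ (by omega))
    have hDbar : Matrix.diagonal
        (fun k : Fin n => d k * (1 - χm ((k : ℕ) + 1)) / (1 - χm (k : ℕ))) = L * (D * K') := by
      rw [hL, hD, hK', Matrix.diagonal_mul_diagonal, Matrix.diagonal_mul_diagonal]
      congr 1
      funext k
      ring
    have e1 : B'⁻¹ * D = D * B⁻¹ := by
      calc B'⁻¹ * D = B'⁻¹ * (D * B) * B⁻¹ := by
            rw [mul_assoc, Matrix.mul_nonsing_inv_cancel_right _ _ uB]
        _ = D * B⁻¹ := by rw [← hBD, Matrix.nonsing_inv_mul_cancel_left _ _ uB']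
    have e2 : B⁻¹ * A * K = K' * A * B⁻¹ := by
      calc B⁻¹ * A * K = B⁻¹ * (A * K * B) * B⁻¹ := by
            rw [mul_assoc B⁻¹ (A * K * B), Matrix.mul_nonsing_inv_cancel_right _ _ uB, mul_assoc]
        _ = K' * A * B⁻¹ := by
            rw [hAKB, mul_assoc B, Matrix.nonsing_inv_mul_cancel_left _ _ uB]
    calc _ = (L * (D * (K' * A * B⁻¹))).charpoly := by rw [hDbar, ePm]; simp only [mul_assoc]
      _ = (L * (D * B⁻¹ * A * K)).charpoly := by rw [← e2]; simp only [mul_assoc]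
      _ = (D * B⁻¹ * A * K * L).charpoly := Matrix.charpoly_mul_comm _ _
      _ = (B'⁻¹ * (D * A)).charpoly := by
          rw [mul_assoc _ K L, hKL, mul_one, ← e1]
          simp only [mul_assoc]
      _ = _ := by rw [Matrix.charpoly_mul_comm, ePp, mul_assoc]
  refine ⟨hcp, ?_⟩
  haveI : Nonempty (Fin n) := ⟨⟨0, by omega⟩⟩
  rw [Matrix.trace_eq_neg_charpoly_coeff, Matrix.trace_eq_neg_charpoly_coeff, hcp]
end

section
/- Let r ≥ 1, C : (Fin r)×(Fin r) → ℤ and d : Fin r → ℝ with d_i ≠ 0 and d_i·C_{ij} = d_j·C_{ji}. Let Ω = {(p,q) ∈ ℂ^r × ℂ^r : p_i ≠ 0, q_i ≠ 0, q_i ≠ 1 for all i}, and define α : Ω → ℂ^r × ℂ^r by α(p,q) = (q, q̃) where q̃_i = (q_i)²·p_i⁻¹·∏_j (1−q_j)^{−C_{ji}}. For x = (p,q) define the antisymmetric (2r)×(2r) matrix Π(x) with Π_{(+,i),(−,j)} = −2·d_i·C_{ij}·p_i·q_j, Π_{(−,j),(+,i)} = 2·d_i·C_{ij}·p_i·q_j,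 and all other entries (the (+,+) and (−,−) blocks) zero. Then α is holomorphic on Ω and for every x ∈ Ω its Jacobian matrix J(x) satisfies J(x)·Π(x)·J(x)ᵀ = Π(α(x)). (The factorization map α is a Poisson map for the bracket {χ⁺_i, χ⁻_j} = −2d_iC_{ij}χ⁺_iχ⁻_j.) -/
open scoped Matrix

/-! Points of `ℂ^r × ℂ^r` are functions `x : (Fin r ⊕ Fin r) → ℂ`, with
`χ⁺_i = p_i = x (inl i)` and `χ⁻_i = q_i = x (inr i)`. -/

/-- The factorization map `α(p,q) = (q, q̃)`, `q̃_i = q_i²·p_i⁻¹·∏_j (1−q_j)^{−C_ji}`. -/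
noncomputable def alphaMap (r : ℕ) (C : Fin r → Fin r → ℤ)
    (x : (Fin r ⊕ Fin r) → ℂ) : (Fin r ⊕ Fin r) → ℂ :=
  Sum.elim (fun i => x (Sum.inr i))
    (fun i => (x (Sum.inr i)) ^ 2 * (x (Sum.inl i))⁻¹ *
      ∏ j : Fin r, (1 - x (Sum.inr j)) ^ (-(C j i)))

/-- The domain `Ω = {(p,q) : p_i ≠ 0, q_i ≠ 0, q_i ≠ 1}`. -/
def Omega (r : ℕ) : Set ((Fin r ⊕ Fin r) → ℂ) :=
  {x | ∀ i : Fin r, x (Sum.inl i) ≠ 0 ∧ x (Sum.inr i) ≠ 0 ∧ x (Sum.inr i) ≠ 1}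

/-- The Jacobian matrix of `α` at `x`: `J(x)_{u,v} = ∂α_u/∂x_v`. -/
noncomputable def jacobian (r : ℕ) (C : Fin r → Fin r → ℤ) (x : (Fin r ⊕ Fin r) → ℂ) :
    Matrix (Fin r ⊕ Fin r) (Fin r ⊕ Fin r) ℂ :=
  fun u v => fderiv ℂ (alphaMap r C) x (Pi.single v 1) u

/-- The Poisson tensor `Π(x)` with `Π_{(+,i),(−,j)} = −2·d_i·C_ij·p_i·q_j`,
`Π_{(−,j),(+,i)} = 2·d_i·C_ij·p_i·q_j`, and vanishing `(+,+)` and `(−,−)` blocks. -/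
noncomputable def poissonTensor (r : ℕ) (C : Fin r → Fin r → ℤ) (d : Fin r → ℝ)
    (x : (Fin r ⊕ Fin r) → ℂ) : Matrix (Fin r ⊕ Fin r) (Fin r ⊕ Fin r) ℂ
  | Sum.inl _, Sum.inl _ => 0
  | Sum.inl i, Sum.inr j => -2 * (d i : ℂ) * (C i j : ℂ) * x (Sum.inl i) * x (Sum.inr j)
  | Sum.inr j, Sum.inl i => 2 * (d i : ℂ) * (C i j : ℂ) * x (Sum.inl i) * x (Sum.inr j)
  | Sum.inr _, Sum.inr _ => 0



/-- Product rule in logarithmic form. -/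
theorem logMul {E : Type*} [NormedAddCommGroup E] [NormedSpace ℂ E] {f g : E → ℂ}
    {f' g' : E →L[ℂ] ℂ} {x : E} (hf : HasFDerivAt f (f x • f') x)
    (hg : HasFDerivAt g (g x • g') x) :
    HasFDerivAt (fun y => f y * g y) ((f x * g x) • (f' + g')) x := by
  refine (hf.mul hg).congr_fderiv ?_
  ext v
  simp
  ring

theorem logProd {E ι : Type*} [NormedAddCommGroup E] [NormedSpace ℂ E] (s : Finset ι)
    {g : ι → E → ℂ} {g' : ι → E →L[ℂ] ℂ} {x : E}
    (hg : ∀ i, HasFDerivAt (g i) (g i x • g' i) x) :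
    HasFDerivAt (fun y => ∏ i ∈ s, g i y) ((∏ i ∈ s, g i x) • ∑ i ∈ s, g' i) x := by
  classical
  induction s using Finset.induction_on with
  | empty => simpa using hasFDerivAt_const (1 : ℂ) x
  | insert a s ha ih =>
    simp only [Finset.prod_insert ha, Finset.sum_insert ha]
    exact logMul (hg a) ih

theorem logComp {E : Type*} [NormedAddCommGroup E] [NormedSpace ℂ E] {h : ℂ → ℂ} {h' : ℂ}
    {l : E →L[ℂ] ℂ} {x : E} (hh : HasDerivAt h (h (l x) * h') (l x)) :
    HasFDerivAt (fun y => h (l y)) (h (l x) • (h' • l)) x := by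
  refine (hh.comp_hasFDerivAt x l.hasFDerivAt).congr_fderiv ?_
  ext v
  simp
  ring

theorem comp_inr (r : ℕ) (C : Fin r → Fin r → ℤ) (x : (Fin r ⊕ Fin r) → ℂ)
    (hx : x ∈ Omega r) (i : Fin r) :
    HasFDerivAt (fun y => alphaMap r C y (Sum.inr i))
      (alphaMap r C x (Sum.inr i) •
        (((2 / x (Sum.inr i)) • (ContinuousLinearMap.proj (Sum.inr i) : ((Fin r ⊕ Fin r) → ℂ) →L[ℂ] ℂ)
          + (-1 / x (Sum.inl i)) • (ContinuousLinearMap.proj (Sum.inl i) : ((Fin r ⊕ Fin r) → ℂ) →L[ℂ] ℂ))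
          + ∑ j, ((C j i : ℂ) / (1 - x (Sum.inr j))) •
            (ContinuousLinearMap.proj (Sum.inr j) : ((Fin r ⊕ Fin r) → ℂ) →L[ℂ] ℂ))) x := by
  simp only [alphaMap, Sum.elim_inr]
  refine logMul (logMul ?_ ?_) (logProd _ fun j => ?_)
  · refine logComp (h := fun z => z ^ 2) (l := (ContinuousLinearMap.proj (R := ℂ) (φ := fun _ : Fin r ⊕ Fin r => ℂ) (Sum.inr i))) ?_
    have := (hx i).2.1
    refine (hasDerivAt_pow 2 _).congr_deriv ?_
    simp
    field_simp
  · refine logComp (h := fun z => z⁻¹) (l := (ContinuousLinearMap.proj (R := ℂ) (φ := fun _ : Fin r ⊕ Fin r => ℂ) (Sum.inl i))) ?_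
    have := (hx i).1
    refine (hasDerivAt_inv this).congr_deriv ?_
    simp
    field_simp
  · refine logComp (h := fun z => (1 - z) ^ (-(C j i)))
      (l := (ContinuousLinearMap.proj (R := ℂ) (φ := fun _ : Fin r ⊕ Fin r => ℂ) (Sum.inr j))) ?_
    have h0 : 1 - x (Sum.inr j) ≠ 0 := sub_ne_zero.2 (hx j).2.2.symm
    have h1 : HasDerivAt (fun z : ℂ => 1 - z) (-1) (x (Sum.inr j)) := by
      simpa using (hasDerivAt_id (x (Sum.inr j))).const_sub 1
    refine ((hasDerivAt_zpow (-(C j i)) _ (Or.inl h0)).comp (x (Sum.inr j)) h1).congr_deriv ?_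
    simp only [ContinuousLinearMap.proj_apply]
    rw [zpow_sub_one₀ h0]
    push_cast
    field_simp

theorem alpha_diff (r : ℕ) (C : Fin r → Fin r → ℤ) (x : (Fin r ⊕ Fin r) → ℂ)
    (hx : x ∈ Omega r) : DifferentiableAt ℂ (alphaMap r C) x := by
  refine differentiableAt_pi.2 fun u => ?_
  rcases u with i | i
  · exact (ContinuousLinearMap.proj (R := ℂ) (φ := fun _ : Fin r ⊕ Fin r => ℂ)
      (Sum.inr i)).differentiableAt
  · exact (comp_inr r C x hx i).differentiableAt

theorem jac_eq (r : ℕ) (C : Fin r → Fin r → ℤ) (x : (Fin r ⊕ Fin r) → ℂ)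
    (hx : x ∈ Omega r) (u v : Fin r ⊕ Fin r) :
    jacobian r C x u v = fderiv ℂ (fun y => alphaMap r C y u) x (Pi.single v 1) := by
  have h := (hasFDerivAt_pi'.1 (alpha_diff r C x hx).hasFDerivAt u).fderiv
  rw [h]
  rfl

theorem jac_inl (r : ℕ) (C : Fin r → Fin r → ℤ) (x : (Fin r ⊕ Fin r) → ℂ)
    (hx : x ∈ Omega r) (i : Fin r) (v : Fin r ⊕ Fin r) :
    jacobian r C x (Sum.inl i) v = if Sum.inr i = v then 1 else 0 := by
  rw [jac_eq r C x hx]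
  have : HasFDerivAt (fun y => alphaMap r C y (Sum.inl i))
      (ContinuousLinearMap.proj (R := ℂ) (φ := fun _ : Fin r ⊕ Fin r => ℂ) (Sum.inr i)) x :=
    (ContinuousLinearMap.proj (R := ℂ) (φ := fun _ : Fin r ⊕ Fin r => ℂ)
      (Sum.inr i)).hasFDerivAt
  rw [this.fderiv]
  simp [Pi.single_apply]

theorem jac_inr_inl (r : ℕ) (C : Fin r → Fin r → ℤ) (x : (Fin r ⊕ Fin r) → ℂ)
    (hx : x ∈ Omega r) (i k : Fin r) :
    jacobian r C x (Sum.inr i) (Sum.inl k) =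
      if i = k then - alphaMap r C x (Sum.inr i) / x (Sum.inl i) else 0 := by
  rw [jac_eq r C x hx, (comp_inr r C x hx i).fderiv]
  simp [Pi.single_apply]
  split_ifs <;> ring

theorem jac_inr_inr (r : ℕ) (C : Fin r → Fin r → ℤ) (x : (Fin r ⊕ Fin r) → ℂ)
    (hx : x ∈ Omega r) (i k : Fin r) :
    jacobian r C x (Sum.inr i) (Sum.inr k) =
      (if i = k then 2 * alphaMap r C x (Sum.inr i) / x (Sum.inr i) else 0) +
        alphaMap r C x (Sum.inr i) * ((C k i : ℂ) / (1 - x (Sum.inr k))) := by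
  rw [jac_eq r C x hx, (comp_inr r C x hx i).fderiv]
  simp [Pi.single_apply]
  split_ifs <;> ring

/-- The factorization map `α` is holomorphic on `Ω` and is a Poisson map for the bracket
`{χ⁺_i, χ⁻_j} = −2d_iC_ijχ⁺_iχ⁻_j`: its Jacobian satisfies `J(x)·Π(x)·J(x)ᵀ = Π(α(x))`. -/
theorem factorization_map_is_poisson
    (r : ℕ) (hr : 1 ≤ r) (C : Fin r → Fin r → ℤ) (d : Fin r → ℝ)
    (hd : ∀ i, d i ≠ 0) (hsym : ∀ i j, d i * (C i j : ℝ) = d j * (C j i : ℝ)) :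
    DifferentiableOn ℂ (alphaMap r C) (Omega r) ∧
    ∀ x ∈ Omega r,
      jacobian r C x * poissonTensor r C d x * (jacobian r C x)ᵀ =
        poissonTensor r C d (alphaMap r C x) := by
  refine ⟨fun x hx => (alpha_diff r C x hx).differentiableWithinAt, fun x hx => ?_⟩
  have hs : ∀ i j, (d i : ℂ) * (C i j : ℂ) = d j * (C j i : ℂ) := fun i j => by
    exact_mod_cast congrArg (fun t : ℝ => (t : ℂ)) (hsym i j)
  ext u v
  simp only [Matrix.mul_apply, Matrix.transpose_apply, Fintype.sum_sum_type]
  rcases u with i | i <;> rcases v with j | j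
  · simp [jac_inl r C x hx, poissonTensor]
  · have hp := (hx j).1
    simp [jac_inl r C x hx, jac_inr_inl r C x hx, poissonTensor]
    have : alphaMap r C x (Sum.inl i) = x (Sum.inr i) := rfl
    rw [this]
    field_simp
    linear_combination (-x (Sum.inr i) * alphaMap r C x (Sum.inr j)) * hs j i
  · have hp := (hx i).1
    simp [jac_inl r C x hx, jac_inr_inl r C x hx, poissonTensor]
    have : alphaMap r C x (Sum.inl j) = x (Sum.inr j) := rfl
    rw [this]
    field_simp
    linear_combination (x (Sum.inr j) * alphaMap r C x (Sum.inr i)) * hs i j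
  · have hp := (hx i).1
    have hp' := (hx j).1
    have hq := (hx i).2.1
    have hq' := (hx j).2.1
    simp [jac_inr_inr r C x hx, jac_inr_inl r C x hx, poissonTensor, add_mul, mul_add,
      Finset.sum_add_distrib]
    generalize alphaMap r C x (Sum.inr i) = A
    generalize alphaMap r C x (Sum.inr j) = B
    have e : ∀ a b c e' : ℂ, a + c = 0 → b + e' = 0 → a + b + (c + e') = 0 := by
      intro a b c e' h1 h2
      linear_combination h1 + h2
    apply e
    · field_simp
      linear_combination 4 * A * B * hs i j
    · rw [Finset.sum_mul, ← sub_eq_add_neg, ← Finset.sum_sub_distrib]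
      refine Finset.sum_eq_zero fun k _ => ?_
      have h0 : 1 - x (Sum.inr k) ≠ 0 := sub_ne_zero.2 (hx k).2.2.symm
      field_simp
      linear_combination 2 * A * B * x (Sum.inr k) * ((C k j : ℂ) * hs i k - (C k i : ℂ) * hs j k)
end

section
/- Let n ≥ 1 and let g be a real n×n matrix such that for every k = 1,…,n the trailing principal minor det(g restricted to rows and columns {k, k+1,…,n}) is positive. Then there exists a unique pair (U, L) where U is upper triangular with positive diagonal entries, L is lower triangular, L_kk·U_kk = 1 for every k, and g = U·L⁻¹. (Unique factorization g = g₊·g₋⁻¹ with θ(g₊) = θ⁻(g₋)⁻¹ on the positive part of the group, specialized to matrices.) -/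
open scoped Matrix

namespace ULaux

lemma sum_sub {n : ℕ} (k : Fin n) (f : Fin n → ℝ) (hf : ∀ i, i < k → f i = 0) :
    ∑ i, f i = ∑ i : {j : Fin n // k ≤ j}, f i := by
  classical
  rw [← Finset.sum_subtype (Finset.univ.filter (fun i => k ≤ i)) (by simp) f]
  symm
  apply Finset.sum_subset (Finset.subset_univ _)
  intro i _ hi
  apply hf
  simpa using hi

/-- trailing block -/
def tr {n : ℕ} (g : Matrix (Fin n) (Fin n) ℝ) (k : Fin n) :
    Matrix {j : Fin n // k ≤ j} {j : Fin n // k ≤ j} ℝ :=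
  g.submatrix (fun j => (j : Fin n)) (fun j => (j : Fin n))

lemma inj {n : ℕ} (g : Matrix (Fin n) (Fin n) ℝ) (k : Fin n) (hk : 0 < (tr g k).det)
    (v : Fin n → ℝ) (hv : ∀ i, i < k → v i = 0) (h : ∀ i, k ≤ i → ∑ l, g i l * v l = 0) :
    v = 0 := by
  have h1 : (tr g k) *ᵥ (fun i => v i) = 0 := by
    ext i
    have := h i i.2
    rw [sum_sub k _ (fun l hl => by rw [hv l hl, mul_zero])] at this
    simpa [tr, Matrix.mulVec, dotProduct] using this
  have h2 := Matrix.eq_zero_of_mulVec_eq_zero hk.ne' h1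
  ext i
  by_cases hi : i < k
  · exact hv i hi
  · exact congrFun h2 ⟨i, not_lt.mp hi⟩

lemma surj {n : ℕ} (g : Matrix (Fin n) (Fin n) ℝ) (k : Fin n) (hk : 0 < (tr g k).det) :
    ∃ v : Fin n → ℝ, (∀ i, i < k → v i = 0) ∧
      (∀ i, k ≤ i → ∑ l, g i l * v l = if i = k then 1 else 0) := by
  classical
  let e : {j : Fin n // k ≤ j} → ℝ := fun i => if (i : Fin n) = k then 1 else 0
  let x := (tr g k)⁻¹ *ᵥ e
  have hx : (tr g k) *ᵥ x = e := by
    simp only [x, Matrix.mulVec_mulVec]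
    rw [Matrix.mul_nonsing_inv _ (isUnit_iff_ne_zero.mpr hk.ne'), Matrix.one_mulVec]
  have h0 : ∀ i, i < k → (fun i => if h : k ≤ i then x ⟨i, h⟩ else 0) i = 0 := by
    intro i hi
    simp [not_le.mpr hi]
  refine ⟨_, h0, ?_⟩
  intro i hi
  rw [sum_sub k _ (fun l hl => by rw [dif_neg (not_le.mpr hl), mul_zero])]
  have := congrFun hx ⟨i, hi⟩
  simp only [e] at this
  rw [← this]
  simp only [Matrix.mulVec, dotProduct, tr, Matrix.submatrix_apply]
  refine Finset.sum_congr rfl fun l _ => ?_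
  rw [dif_pos l.2]

lemma det_tr_lower {n : ℕ} (M : Matrix (Fin n) (Fin n) ℝ) (hM : ∀ i j, i < j → M i j = 0)
    (k : Fin n) : (tr M k).det = ∏ i : {j : Fin n // k ≤ j}, M i i := by
  rw [Matrix.det_of_isLowerTriangular]
  · rfl
  · intro i j hij
    exact hM _ _ hij

lemma det_tr_upper {n : ℕ} (M : Matrix (Fin n) (Fin n) ℝ) (hM : ∀ i j, j < i → M i j = 0)
    (k : Fin n) : (tr M k).det = ∏ i : {j : Fin n // k ≤ j}, M i i := by
  rw [Matrix.det_of_isUpperTriangular]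
  · rfl
  · intro i j hij
    exact hM _ _ hij

lemma tr_mul {n : ℕ} (g M : Matrix (Fin n) (Fin n) ℝ) (hM : ∀ i j, i < j → M i j = 0)
    (k : Fin n) : tr (g * M) k = tr g k * tr M k := by
  ext i j
  simp only [tr, Matrix.submatrix_apply, Matrix.mul_apply]
  exact sum_sub k _ (fun l hl => by rw [hM l j (lt_of_lt_of_le hl j.2), mul_zero])

lemma prod_split {n : ℕ} (f : Fin n → ℝ) (k : Fin n) :
    ∏ i : {j : Fin n // k ≤ j}, f i = f k * ∏ i ∈ Finset.Ioi k, f i := by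
  rw [← Finset.prod_subtype (Finset.Ici k) (by simp) f, ← Finset.Ioi_insert k,
    Finset.prod_insert (by simp)]

lemma isUnit_lower {n : ℕ} (L : Matrix (Fin n) (Fin n) ℝ) (hL : ∀ i j, i < j → L i j = 0)
    (h : ∀ i, L i i ≠ 0) : IsUnit L.det := by
  rw [Matrix.det_of_isLowerTriangular L (fun i j hij => hL _ _ hij)]
  exact isUnit_iff_ne_zero.mpr (Finset.prod_ne_zero_iff.mpr fun i _ => h i)

end ULaux

open ULaux in
/-- Unique factorization `g = g₊·g₋⁻¹` with `θ(g₊) = θ⁻(g₋)⁻¹` on the positive part of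
the group, specialized to matrices: if every trailing principal minor of a real `n×n`
matrix `g` is positive, then there is a unique pair `(U, L)` with `U` upper triangular
with positive diagonal, `L` lower triangular, `L_kk·U_kk = 1` for all `k`, and
`g = U·L⁻¹`. -/
theorem unique_positive_UL_factorization
    (n : ℕ) (hn : 1 ≤ n) (g : Matrix (Fin n) (Fin n) ℝ)
    (hminors : ∀ k : Fin n,
      0 < (g.submatrix (fun j : {j : Fin n // k ≤ j} => (j : Fin n))
            (fun j : {j : Fin n // k ≤ j} => (j : Fin n))).det) :
    ∃! p : Matrix (Fin n) (Fin n) ℝ × Matrix (Fin n) (Fin n) ℝ,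
      (∀ i j : Fin n, j < i → p.1 i j = 0) ∧
      (∀ i : Fin n, 0 < p.1 i i) ∧
      (∀ i j : Fin n, i < j → p.2 i j = 0) ∧
      (∀ i : Fin n, p.2 i i * p.1 i i = 1) ∧
      g = p.1 * p.2⁻¹ := by
  have hm : ∀ k, 0 < (tr g k).det := hminors
  apply existsUnique_of_exists_of_unique
  · choose v hv0 hv1 using fun k => surj g k (hm k)
    let M : Matrix (Fin n) (Fin n) ℝ := Matrix.of fun i j => v j i
    have hM : ∀ i j, i < j → M i j = 0 := fun i j hij => hv0 j i hij
    have hgM : ∀ i j, j ≤ i → (g * M) i j = if i = j then 1 else 0 := fun i j hij => by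
      rw [Matrix.mul_apply]; exact hv1 j i hij
    have hdet : ∀ k, (tr g k).det * (M k k * ∏ i ∈ Finset.Ioi k, M i i) = 1 := by
      intro k
      rw [← prod_split (fun i => M i i), ← det_tr_lower M hM, ← Matrix.det_mul, ← tr_mul g M hM,
        det_tr_upper]
      · apply Finset.prod_eq_one
        intro i _
        rw [hgM _ _ le_rfl, if_pos rfl]
      · intro i j hij
        rw [hgM _ _ hij.le, if_neg hij.ne']
    have hpos : ∀ k, 0 < M k k := by
      intro k
      induction k using WellFoundedGT.induction with
      | ind k ih =>
        have hp : 0 < ∏ i ∈ Finset.Ioi k, M i i :=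
          Finset.prod_pos fun i hi => ih i (Finset.mem_Ioi.mp hi)
        have h1 := hdet k
        have h2 : 0 < M k k * ∏ i ∈ Finset.Ioi k, M i i :=
          (mul_pos_iff_of_pos_left (hm k)).mp (by rw [h1]; exact one_pos)
        exact (mul_pos_iff_of_pos_right hp).mp h2
    let c : Fin n → ℝ := fun k => (√(M k k))⁻¹
    have hc : ∀ k, 0 < c k := fun k => inv_pos.mpr (Real.sqrt_pos.mpr (hpos k))
    have hcM : ∀ k, M k k * c k * c k = 1 := by
      intro k
      have h1 := Real.mul_self_sqrt (hpos k).le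
      have h2 := (Real.sqrt_pos.mpr (hpos k)).ne'
      simp only [c]
      field_simp
      nlinarith
    have hL : ∀ i j, i < j → (M * Matrix.diagonal c) i j = 0 := by
      intro i j hij
      rw [Matrix.mul_diagonal, hM i j hij, zero_mul]
    have hU : ∀ i, (g * M * Matrix.diagonal c) i i = c i := by
      intro i
      rw [Matrix.mul_diagonal, hgM i i le_rfl, if_pos rfl, one_mul]
    refine ⟨(g * M * Matrix.diagonal c, M * Matrix.diagonal c), ?_, ?_, hL, ?_, ?_⟩
    · intro i j hij
      simp only
      rw [Matrix.mul_diagonal, hgM i j hij.le, if_neg hij.ne', zero_mul]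
    · intro i
      simp only
      rw [hU]; exact hc i
    · intro i
      simp only
      rw [hU, Matrix.mul_diagonal]; exact hcM i
    · simp only
      rw [Matrix.mul_assoc g, Matrix.mul_assoc, Matrix.mul_nonsing_inv, Matrix.mul_one]
      apply isUnit_lower _ hL
      intro i
      rw [Matrix.mul_diagonal]
      exact (mul_pos (hpos i) (hc i)).ne'
  · rintro ⟨U, L⟩ ⟨U', L'⟩ ⟨h1, h2, h3, h4, h5⟩ ⟨h1', h2', h3', h4', h5'⟩
    simp only at *
    have e : g * L = U := by
      rw [h5, Matrix.mul_assoc, Matrix.nonsing_inv_mul, Matrix.mul_one]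
      exact isUnit_lower _ h3 fun i hi => by simpa [hi] using h4 i
    have e' : g * L' = U' := by
      rw [h5', Matrix.mul_assoc, Matrix.nonsing_inv_mul, Matrix.mul_one]
      exact isUnit_lower _ h3' fun i hi => by simpa [hi] using h4' i
    have key : ∀ j i, U' j j * L i j = U j j * L' i j := by
      intro j i
      have := inj g j (hm j) (fun i => U' j j * L i j - U j j * L' i j)
        (fun i hi => by simp [h3 i j hi, h3' i j hi]) (by
          intro i hi
          have a : ∑ l, g i l * (U' j j * L l j - U j j * L' l j)
              = U' j j * (g * L) i j - U j j * (g * L') i j := by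
            simp only [Matrix.mul_apply, Finset.mul_sum, ← Finset.sum_sub_distrib]
            exact Finset.sum_congr rfl fun l _ => by ring
          rw [a, e, e']
          rcases hi.eq_or_lt with rfl | hi
          · ring
          · rw [h1 i j hi, h1' i j hi]; ring)
      exact sub_eq_zero.mp (congrFun this i)
    have hd : ∀ j, U j j = U' j j := by
      intro j
      have k := key j j
      have a := h4 j
      have a' := h4' j
      have s : U j j * U j j = U' j j * U' j j := by
        linear_combination (-U j j * U' j j) * k + (U' j j * U' j j) * a - (U j j * U j j) * a'
      nlinarith [h2 j, h2' j, mul_self_inj (h2 j).le (h2' j).le |>.mp s]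
    have hLL : L = L' := by
      ext i j
      have k := key j i
      rw [← hd j] at k
      exact mul_left_cancel₀ (h2 j).ne' k
    rw [← e, ← e', hLL]
end

section
/- Let r ≥ 1 and C : (Fin r)×(Fin r) → ℤ. Define α on pairs of positive vectors by α(u⁺, u⁻) = (u⁻, v) where v_i = (u⁻_i)²·(u⁺_i)⁻¹·∏_j (1 + u⁻_j)^{−C_{ji}}. Then α maps (ℝ_{>0})^r × (ℝ_{>0})^r into itself and is a bijection of (ℝ_{>0})^r × (ℝ_{>0})^r onto itself, with inverse (v⁺, v⁻) ↦ (w, v⁺) where w_i = (v⁺_i)²·(v⁻_i)⁻¹·∏_j (1 + v⁺_j)^{−C_{ji}}. (The factorization map α is globally defined and invertible on the positive real domain.) -/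
/-- The factorization map `α(u⁺,u⁻) = (u⁻, v)`, `v_i = (u⁻_i)²·(u⁺_i)⁻¹·∏_j (1+u⁻_j)^(−C_ji)`,
is globally defined and invertible on the positive real domain: it maps the set of pairs of
positive vectors bijectively onto itself, with inverse
`(v⁺,v⁻) ↦ (w, v⁺)`, `w_i = (v⁺_i)²·(v⁻_i)⁻¹·∏_j (1+v⁺_j)^(−C_ji)`. -/
theorem factorization_map_bijective_on_positive_domain
    (r : ℕ) (hr : 1 ≤ r) (C : Fin r → Fin r → ℤ) :
    let P : Set ((Fin r → ℝ) × (Fin r → ℝ)) :=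
      {p | (∀ i, 0 < p.1 i) ∧ (∀ i, 0 < p.2 i)}
    let α : (Fin r → ℝ) × (Fin r → ℝ) → (Fin r → ℝ) × (Fin r → ℝ) :=
      fun p => (p.2, fun i => (p.2 i) ^ 2 * (p.1 i)⁻¹ * ∏ j, (1 + p.2 j) ^ (-(C j i)))
    let β : (Fin r → ℝ) × (Fin r → ℝ) → (Fin r → ℝ) × (Fin r → ℝ) :=
      fun q => ((fun i => (q.1 i) ^ 2 * (q.2 i)⁻¹ * ∏ j, (1 + q.1 j) ^ (-(C j i))), q.1)
    (∀ p ∈ P, α p ∈ P) ∧ Set.BijOn α P P ∧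
      (∀ p ∈ P, β p ∈ P ∧ α (β p) = p ∧ β (α p) = p) := by
  intro P α β
  have hprod : ∀ (u : Fin r → ℝ), (∀ i, 0 < u i) → ∀ i,
      0 < ∏ j, (1 + u j) ^ (-(C j i)) := fun u hu i =>
    Finset.prod_pos fun j _ => zpow_pos (by linarith [hu j]) _
  have key : ∀ a b c : ℝ, 0 < a → 0 < b → 0 < c → a ^ 2 * (a ^ 2 * b⁻¹ * c)⁻¹ * c = b := by
    intro a b c ha hb hc
    field_simp
  have hα : ∀ p ∈ P, α p ∈ P := by
    rintro ⟨u, v⟩ ⟨hu, hv⟩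
    exact ⟨hv, fun i => mul_pos (mul_pos (pow_pos (hv i) 2) (inv_pos.2 (hu i))) (hprod v hv i)⟩
  have hβ : ∀ p ∈ P, β p ∈ P := by
    rintro ⟨u, v⟩ ⟨hu, hv⟩
    exact ⟨fun i => mul_pos (mul_pos (pow_pos (hu i) 2) (inv_pos.2 (hv i))) (hprod u hu i), hu⟩
  have hαβ : ∀ p ∈ P, α (β p) = p := by
    rintro ⟨u, v⟩ ⟨hu, hv⟩
    exact Prod.ext rfl (funext fun i => key _ _ _ (hu i) (hv i) (hprod u hu i))
  have hβα : ∀ p ∈ P, β (α p) = p := by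
    rintro ⟨u, v⟩ ⟨hu, hv⟩
    exact Prod.ext (funext fun i => key _ _ _ (hv i) (hu i) (hprod v hv i)) rfl
  exact ⟨hα, Set.InvOn.bijOn ⟨hβα, hαβ⟩ hα hβ, fun p hp => ⟨hβ p hp, hαβ p hp, hβα p hp⟩⟩
end
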